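/- arXiv:2012.10946 — 2 statements merged into one kernel-verified Lean document; each statement's English description precedes it below -/
import Mathlib

section
/- For each t > 0 there is a unique continuous function P_t : ℝ^d × ℝ^d → ℝ with P_t(X,Y) = (|W| (4πt)^{d/2} π(X)π(Y))^{−1} ∑_{w∈W} det(w) exp(−|X − wY|²/(4t)) whenever π(X)π(Y) ≠ 0. Let X and Y lie in the closed positive Weyl chamber {Z : ⟨α,Z⟩ ≥ 0 for all α ∈ Σ⁺}, both singular, and assume {w ∈ W : ⟨X, wY⟩ = ⟨X, Y⟩} = {w₁w₂ : w₁ ∈ W_X, w₂ ∈ W_Y}. Let M = Σ⁺ ∖ (Σ⁺_X ∪ Σ⁺_Y), m = |M|, m' = |Σ⁺_X ∪ Σ⁺_Y| (so γ = m + m'), and π_M(Z) = ∏_{α∈M} ⟨α,Z⟩. Then lim_{t→0⁺} t^{d/2+m'} e^{|X−Y|²/(4t)} P_t(X,Y) = (c_{X,Y}/(c_X c_Y)) · (|W_X||W_Y|/|W_X ∩ W_Y|) · (π_M(X) π_M(Y))^{−1} · 2^{−m'−d} π^{−d/2} |W|^{−1}. -/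
open scoped BigOperators RealInnerProductSpace Classical
open Finset

noncomputable section

/-- Euclidean space `ℝ^d`. -/
abbrev E (d : ℕ) := EuclideanSpace ℝ (Fin d)

/-- The reflection `s_α x = x - 2 (⟪α, x⟫/⟪α, α⟫) α` fixing the hyperplane `α^⊥`. -/
def reflVec {d : ℕ} (α x : E d) : E d := x - (2 * ⟪α, x⟫ / ⟪α, α⟫) • α

/-- `Sig` is a reduced root system in `ℝ^d`: a finite set of nonzero vectors spanning `ℝ^d`,
with `Sig ∩ ℝα = {α, -α}` and `s_α (Sig) = Sig` for all `α ∈ Sig`. -/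
def IsRootSystem {d : ℕ} (Sig : Finset (E d)) : Prop :=
  (0 : E d) ∉ Sig ∧
  Submodule.span ℝ (Sig : Set (E d)) = ⊤ ∧
  (∀ α ∈ Sig, ∀ t : ℝ, t • α ∈ Sig → t = 1 ∨ t = -1) ∧
  (∀ α ∈ Sig, ∀ β ∈ Sig, reflVec α β ∈ Sig)

/-- `Sp` is a positive system for `Sig`: `Sp = {α ∈ Sig : ⟪α, v⟫ > 0}` for a vector `v` not
orthogonal to any root. -/
def IsPositiveSystem {d : ℕ} (Sig Sp : Finset (E d)) : Prop :=
  ∃ v : E d, (∀ α ∈ Sig, ⟪α, v⟫ ≠ 0) ∧ ∀ α : E d, α ∈ Sp ↔ α ∈ Sig ∧ 0 < ⟪α, v⟫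

/-- The Weyl group of `Sig`: the subgroup of the orthogonal group of `ℝ^d` generated by the
reflections `s_α`, `α ∈ Sig`. -/
def weylGroup {d : ℕ} (Sig : Finset (E d)) : Subgroup (E d ≃ₗᵢ[ℝ] E d) :=
  Subgroup.closure {w : E d ≃ₗᵢ[ℝ] E d | ∃ α ∈ Sig, ∀ x : E d, w x = reflVec α x}

/-- Determinant of an orthogonal transformation (`±1`). -/
def dsign {d : ℕ} (w : E d ≃ₗᵢ[ℝ] E d) : ℝ := LinearMap.det (w.toLinearEquiv.toLinearMap)

/-- `π(X) = ∏_{α ∈ Sp} ⟪α, X⟫`. -/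
def piP {d : ℕ} (Sp : Finset (E d)) (X : E d) : ℝ := ∏ α ∈ Sp, ⟪α, X⟫

/-- Composition of directional-derivative operators along the vectors of a list. -/
def Dop {d : ℕ} : List (E d) → (E d → ℝ) → E d → ℝ
  | [], f => f
  | v :: L, f => fun x => fderiv ℝ (Dop L f) x v

/-- The constant `c_S = ∂(π_S)(π_S)` attached to a finite set `S` of vectors (the derivative
is a constant function; we evaluate it at `0`). -/
def cConst {d : ℕ} (S : Finset (E d)) : ℝ := Dop S.toList (piP S) 0

/-- The reflection in the hyperplane `α^⊥`, as a linear isometry. -/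
def rootReflection {d : ℕ} (α : E d) : E d ≃ₗᵢ[ℝ] E d := (ℝ ∙ α)ᗮ.reflection

lemma rootReflection_apply {d : ℕ} (α x : E d) : rootReflection α x = reflVec α x := by
  unfold rootReflection reflVec
  rw [Submodule.reflection_orthogonal_apply, Submodule.reflection_singleton_apply, neg_sub,
    real_inner_self_eq_norm_sq, two_smul, ← add_smul, mul_div_assoc, two_mul]
  rfl

lemma rootReflection_self {d : ℕ} (α : E d) : rootReflection α α = -α :=
  Submodule.reflection_orthogonalComplement_singleton_eq_neg α

lemma rootReflection_mul_self {d : ℕ} (α : E d) : rootReflection α * rootReflection α = 1 :=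
  Submodule.reflection_mul_reflection _

lemma rootReflection_involutive {d : ℕ} (α x : E d) :
    rootReflection α (rootReflection α x) = x :=
  Submodule.reflection_reflection _ x

lemma inner_rootReflection_left {d : ℕ} (α x y : E d) :
    ⟪rootReflection α x, y⟫ = ⟪x, rootReflection α y⟫ := by
  conv_lhs => rw [← (rootReflection α).inner_map_map, rootReflection_involutive]

lemma inner_rootReflection_right {d : ℕ} (α x y : E d) :
    ⟪x, rootReflection α y⟫ = ⟪x, y⟫ - 2 * ⟪α, y⟫ / ⟪α, α⟫ * ⟪x, α⟫ := by
  rw [rootReflection_apply, reflVec, inner_sub_right, inner_smul_right]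

lemma rootReflection_eq_self {d : ℕ} {α x : E d} (h : ⟪α, x⟫ = 0) :
    rootReflection α x = x := by
  simp [rootReflection_apply, reflVec, h]

lemma dsign_one {d : ℕ} : dsign (1 : E d ≃ₗᵢ[ℝ] E d) = 1 :=
  LinearMap.det_id

lemma dsign_mul {d : ℕ} (w w' : E d ≃ₗᵢ[ℝ] E d) : dsign (w * w') = dsign w * dsign w' :=
  LinearMap.det_comp _ _

lemma dsign_rootReflection {d : ℕ} {α : E d} (hα : α ≠ 0) : dsign (rootReflection α) = -1 := by
  have h := Submodule.det_reflection (𝕜 := ℝ) (ℝ ∙ α)ᗮ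
  rw [Submodule.orthogonal_orthogonal, finrank_span_singleton hα, pow_one] at h
  exact h

lemma rootReflection_mem_weylGroup {d : ℕ} {Sig : Finset (E d)} {α : E d} (hα : α ∈ Sig) :
    rootReflection α ∈ weylGroup Sig :=
  Subgroup.subset_closure ⟨α, hα, rootReflection_apply α⟩

lemma weylGroup_eq_closure {d : ℕ} (Sig : Finset (E d)) :
    weylGroup Sig = Subgroup.closure (rootReflection '' (Sig : Set (E d))) := by
  unfold weylGroup
  congr 1
  ext w
  constructor
  · rintro ⟨α, hα, h⟩
    exact ⟨α, hα, by ext1 x; rw [h, rootReflection_apply]⟩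
  · rintro ⟨α, hα, rfl⟩
    exact ⟨α, hα, rootReflection_apply α⟩

lemma dsign_inv {d : ℕ} (w : E d ≃ₗᵢ[ℝ] E d) : dsign w⁻¹ * dsign w = 1 := by
  rw [← dsign_mul, inv_mul_cancel, dsign_one]

lemma dsign_mul_self {d : ℕ} {Sig : Finset (E d)} (h0 : (0 : E d) ∉ Sig) {w : E d ≃ₗᵢ[ℝ] E d}
    (hw : w ∈ weylGroup Sig) : dsign w * dsign w = 1 := by
  rw [weylGroup_eq_closure] at hw
  induction hw using Subgroup.closure_induction with
  | mem x hx =>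
    obtain ⟨α, hα, rfl⟩ := hx
    rw [dsign_rootReflection (fun h => h0 (h ▸ hα))]; norm_num
  | one => simp [dsign_one]
  | mul x y _ _ hx hy =>
    rw [dsign_mul]
    linear_combination (dsign y * dsign y) * hx + hy
  | inv x _ hx =>
    have h := dsign_inv x
    have h2 : dsign x⁻¹ = dsign x := by
      linear_combination dsign x * h - dsign x⁻¹ * hx
    rw [h2, hx]

lemma weylGroup_map_mem_iff {d : ℕ} {Sig : Finset (E d)} (hroot : IsRootSystem Sig)
    {w : E d ≃ₗᵢ[ℝ] E d} (hw : w ∈ weylGroup Sig) (β : E d) : w β ∈ Sig ↔ β ∈ Sig := by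
  rw [weylGroup_eq_closure] at hw
  induction hw using Subgroup.closure_induction generalizing β with
  | mem x hx =>
    obtain ⟨α, hα, rfl⟩ := hx
    have key : ∀ γ ∈ Sig, rootReflection α γ ∈ Sig := fun γ hγ => by
      rw [rootReflection_apply]; exact hroot.2.2.2 α hα γ hγ
    refine ⟨fun h => ?_, key β⟩
    have := key _ h
    rwa [rootReflection_involutive] at this
  | one => rfl
  | mul x y _ _ hx hy => rw [LinearIsometryEquiv.coe_mul, Function.comp_apply, hx, hy]
  | inv x _ hx =>
    rw [← hx, ← Function.comp_apply (f := x), ← LinearIsometryEquiv.coe_mul, mul_inv_cancel]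
    rfl

section PositiveSystems

variable {d : ℕ} {Sig Sp : Finset (E d)} {v : E d}

lemma neg_mem_of_isRootSystem (hroot : IsRootSystem Sig) {α : E d} (hα : α ∈ Sig) : -α ∈ Sig := by
  rw [← rootReflection_self, rootReflection_apply]
  exact hroot.2.2.2 α hα α hα

/-- `v` witnesses that `Sp` is a positive system of `Sig`. -/
def PositiveFor (Sig Sp : Finset (E d)) (v : E d) : Prop :=
  (∀ α ∈ Sig, ⟪α, v⟫ ≠ 0) ∧ ∀ α : E d, α ∈ Sp ↔ α ∈ Sig ∧ 0 < ⟪α, v⟫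

lemma PositiveFor.mem_or_neg_mem (hv : PositiveFor Sig Sp v) (hroot : IsRootSystem Sig) {α : E d}
    (hα : α ∈ Sig) : α ∈ Sp ∨ -α ∈ Sp := by
  rcases lt_or_gt_of_ne (hv.1 α hα) with h | h
  · right
    rw [hv.2]
    exact ⟨neg_mem_of_isRootSystem hroot hα, by rw [inner_neg_left]; linarith⟩
  · left
    rw [hv.2]
    exact ⟨hα, h⟩

lemma PositiveFor.eq_of_smul (hv : PositiveFor Sig Sp v) (hroot : IsRootSystem Sig) {α : E d}
    (hα : α ∈ Sp) {c : ℝ} (hc : c • α ∈ Sp) : c = 1 := by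
  have h1 := (hv.2 _).1 hα
  have h2 := (hv.2 _).1 hc
  rcases hroot.2.2.1 α h1.1 c h2.1 with h | h
  · exact h
  · rw [h, inner_smul_left] at h2
    simp at h2
    linarith [h2.2, h1.2]

lemma PositiveFor.ne_zero (hv : PositiveFor Sig Sp v) {α : E d} (hα : α ∈ Sp) : α ≠ 0 := by
  rintro rfl
  simpa using ((hv.2 _).1 hα).2

/-- Simple roots: a subset `S` of the positive roots whose reflections permute the remaining
positive roots, and which is not obtuse to any positive root. -/
structure IsSimpleSystem (Sp S : Finset (E d)) : Prop where
  subset : S ⊆ Sp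
  reflection_mem : ∀ σ ∈ S, ∀ β ∈ Sp, β ≠ σ → rootReflection σ β ∈ Sp
  exists_pos : ∀ γ ∈ Sp, ∃ σ ∈ S, 0 < ⟪γ, σ⟫

lemma inner_nonneg_of_mem_span {S : Set (E d)} {x y : E d} (h : ∀ σ ∈ S, 0 ≤ ⟪σ, y⟫)
    (hx : x ∈ Submodule.span NNReal S) : 0 ≤ ⟪x, y⟫ := by
  induction hx using Submodule.span_induction with
  | mem x hx => exact h x hx
  | zero => simp
  | add x z _ _ hx hz => rw [inner_add_left]; linarith
  | smul a x _ hx =>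
    rw [NNReal.smul_def, real_inner_smul_left]
    exact mul_nonneg a.2 hx

lemma eq_zero_of_mem_span {S : Set (E d)} {x y : E d} (h : ∀ σ ∈ S, 0 < ⟪σ, y⟫)
    (hx : x ∈ Submodule.span NNReal S) (h0 : ⟪x, y⟫ ≤ 0) : x = 0 := by
  induction hx using Submodule.span_induction with
  | mem x hx => exact absurd (h x hx) (not_lt.2 h0)
  | zero => rfl
  | add x z hx' hz' hx hz =>
    have h1 := inner_nonneg_of_mem_span (fun σ hσ => (h σ hσ).le) hx'
    have h2 := inner_nonneg_of_mem_span (fun σ hσ => (h σ hσ).le) hz'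
    rw [inner_add_left] at h0
    rw [hx (by linarith), hz (by linarith), add_zero]
  | smul a x hx' hx =>
    have h1 := inner_nonneg_of_mem_span (fun σ hσ => (h σ hσ).le) hx'
    rw [NNReal.smul_def, real_inner_smul_left] at h0
    rcases eq_or_lt_of_le a.2 with ha | ha
    · have : a = 0 := by ext; exact ha.symm
      simp [this]
    · rw [hx (by
        by_contra hcon
        push Not at hcon
        exact absurd (mul_pos ha hcon) (not_lt.2 h0)), smul_zero]

lemma PositiveFor.exists_isSimpleSystem (hv : PositiveFor Sig Sp v) (hroot : IsRootSystem Sig) :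
    ∃ S, IsSimpleSystem Sp S := by
  let 𝒮 : Finset (Finset (E d)) := Sp.powerset.filter
    (fun S : Finset (E d) => (Sp : Set (E d)) ⊆ Submodule.span NNReal (S : Set (E d)))
  have hne : 𝒮.Nonempty := ⟨Sp, by simp [𝒮, Submodule.subset_span]⟩
  obtain ⟨S, hS, hmin⟩ := Finset.exists_min_image 𝒮 Finset.card hne
  simp only [𝒮, mem_filter, mem_powerset] at hS hmin
  have hpos : ∀ σ ∈ S, 0 < ⟪σ, v⟫ := fun σ hσ => ((hv.2 _).1 (hS.1 hσ)).2
  refine ⟨S, hS.1, ?_, ?_⟩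
  · intro σ hσ β hβ hne
    by_contra hcon
    have hβ' := (hv.2 _).1 hβ
    have hσ' := (hv.2 _).1 (hS.1 hσ)
    have hmem : rootReflection σ β ∈ Sig :=
      (weylGroup_map_mem_iff hroot (rootReflection_mem_weylGroup hσ'.1) β).2 hβ'.1
    have hδ := (hv.mem_or_neg_mem hroot hmem).resolve_left hcon
    obtain ⟨T, hTσ, rfl⟩ : ∃ T, σ ∉ T ∧ insert σ T = S :=
      ⟨S.erase σ, by simp, Finset.insert_erase hσ⟩
    have h1 := hS.2 hβ
    have h2 := hS.2 hδ
    simp only [SetLike.mem_coe, coe_insert] at h1 h2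
    rw [Submodule.mem_span_insert] at h1 h2
    obtain ⟨a, z, hz, h1⟩ := h1
    obtain ⟨b, y, hy, h2⟩ := h2
    set c : ℝ := 2 * ⟪σ, β⟫ / ⟪σ, σ⟫
    have h3 : rootReflection σ β = β - c • σ := rootReflection_apply _ _
    have h4 : (c - a - b) • σ = z + y := by
      rw [h3] at h2
      have e1 : c • σ = β + ((b : ℝ) • σ + y) := by
        rw [← NNReal.smul_def, ← h2]; abel
      rw [sub_smul, sub_smul, e1, h1, NNReal.smul_def]
      abel
    have hzy := Submodule.add_mem _ hz hy
    rcases le_or_gt (c - a - b) 0 with hle | hlt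
    · have h5 : z + y = 0 := by
        refine eq_zero_of_mem_span (y := v) (fun τ hτ => hpos τ (by simp at hτ; simp [hτ])) hzy ?_
        rw [← h4, real_inner_smul_left]
        exact mul_nonpos_of_nonpos_of_nonneg hle hσ'.2.le
      have h6 : z = 0 := by
        refine eq_zero_of_mem_span (y := v) (fun τ hτ => hpos τ (by simp at hτ; simp [hτ])) hz ?_
        have := inner_nonneg_of_mem_span (y := v)
          (fun τ hτ => (hpos τ (by simp at hτ; simp [hτ])).le) hy
        have h7 : ⟪z + y, v⟫ = 0 := by rw [h5, inner_zero_left]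
        rw [inner_add_left] at h7
        linarith
      rw [h6, add_zero, NNReal.smul_def] at h1
      have := hv.eq_of_smul hroot (hS.1 hσ) (c := a) (h1 ▸ hβ)
      exact hne (by rw [h1, this, one_smul])
    · have hσT : σ ∈ Submodule.span NNReal (T : Set (E d)) := by
        have : σ = (c - a - b)⁻¹.toNNReal • (z + y) := by
          rw [← h4, NNReal.smul_def, Real.coe_toNNReal _ (inv_pos.2 hlt).le, smul_smul,
            inv_mul_cancel₀ hlt.ne', one_smul]
        rw [this]
        exact Submodule.smul_mem _ _ hzy
      have := hmin T ⟨fun τ hτ => hS.1 (by simp [hτ]), by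
        refine hS.2.trans ?_
        have : Submodule.span NNReal ((insert σ T : Finset (E d)) : Set (E d)) ≤
            Submodule.span NNReal (T : Set (E d)) := by
          rw [Submodule.span_le, coe_insert]
          exact Set.insert_subset hσT Submodule.subset_span
        exact this⟩
      rw [card_insert_of_notMem hTσ] at this
      omega
  · intro γ hγ
    by_contra! hcon
    have h1 := inner_nonneg_of_mem_span (y := -γ) (fun σ hσ => by
      have := hcon σ hσ
      rw [inner_neg_right, real_inner_comm]
      linarith) (hS.2 hγ)
    rw [inner_neg_right] at h1
    have := real_inner_self_pos.2 (hv.ne_zero hγ)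
    linarith

end PositiveSystems

section WeylAction
variable {d : ℕ} {Sig Sp S : Finset (E d)} {v : E d}

lemma inner_inv_apply_left {d : ℕ} (w : E d ≃ₗᵢ[ℝ] E d) (x y : E d) : ⟪w⁻¹ x, y⟫ = ⟪x, w y⟫ := by
  rw [← w.inner_map_map (w⁻¹ x) y]
  congr 1
  exact w.apply_symm_apply x

lemma inner_inv_apply_right {d : ℕ} (w : E d ≃ₗᵢ[ℝ] E d) (x y : E d) :
    ⟪x, w⁻¹ y⟫ = ⟪w x, y⟫ := by
  rw [real_inner_comm, inner_inv_apply_left, real_inner_comm]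

lemma conj_rootReflection {d : ℕ} (w : E d ≃ₗᵢ[ℝ] E d) (α : E d) :
    w * rootReflection α * w⁻¹ = rootReflection (w α) := by
  ext1 x
  rw [LinearIsometryEquiv.coe_mul, Function.comp_apply, LinearIsometryEquiv.coe_mul,
    Function.comp_apply, rootReflection_apply, rootReflection_apply, reflVec, reflVec, map_sub,
    map_smul, w.inner_map_map, inner_inv_apply_right]
  congr 1
  exact w.apply_symm_apply x

lemma rootReflection_neg {d : ℕ} (α : E d) : rootReflection (-α) = rootReflection α := by
  ext1 x
  simp [rootReflection_apply, reflVec, neg_div, sub_eq_add_neg]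

lemma PositiveFor.neg_notMem (hv : PositiveFor Sig Sp v) {α : E d} (hα : α ∈ Sp) : -α ∉ Sp := by
  intro h
  have h1 := ((hv.2 _).1 hα).2
  have h2 := ((hv.2 _).1 h).2
  rw [inner_neg_left] at h2
  linarith

lemma IsSimpleSystem.weylGroup_le (hS : IsSimpleSystem Sp S) (hv : PositiveFor Sig Sp v)
    (hroot : IsRootSystem Sig) :
    weylGroup Sig ≤ Subgroup.closure (rootReflection '' (S : Set (E d))) := by
  set G := Subgroup.closure (rootReflection '' (S : Set (E d)))
  have key : ∀ β ∈ Sp, rootReflection β ∈ G := by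
    intro β hβ
    have hne : (Sp.filter fun γ => ∃ u ∈ G, u β = γ).Nonempty :=
      ⟨β, by simp only [mem_filter]; exact ⟨hβ, 1, G.one_mem, rfl⟩⟩
    obtain ⟨γ, hγ, hmin⟩ := Finset.exists_min_image _ (fun γ => ⟪γ, v⟫) hne
    simp only [mem_filter] at hγ hmin
    obtain ⟨hγ, u, hu, rfl⟩ := hγ
    obtain ⟨σ, hσ, hpos⟩ := hS.exists_pos _ hγ
    have hσG : rootReflection σ ∈ G := Subgroup.subset_closure ⟨σ, hσ, rfl⟩
    by_cases h : u β = σ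
    · have : rootReflection β = u⁻¹ * rootReflection σ * u := by
        rw [← h, ← conj_rootReflection]; group
      rw [this]
      exact G.mul_mem (G.mul_mem (G.inv_mem hu) hσG) hu
    · have h1 := hmin _ ⟨hS.reflection_mem σ hσ _ hγ h, rootReflection σ * u,
        G.mul_mem hσG hu, rfl⟩
      have hσ' := ((hv.2 _).1 (hS.subset hσ))
      rw [inner_rootReflection_left, inner_rootReflection_right] at h1
      have h2 : 0 < 2 * ⟪σ, v⟫ / ⟪σ, σ⟫ :=
        div_pos (by linarith [hσ'.2]) (real_inner_self_pos.2 (hv.ne_zero (hS.subset hσ)))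
      have := mul_pos h2 hpos
      linarith
  rw [weylGroup_eq_closure, Subgroup.closure_le]
  rintro _ ⟨β, hβ, rfl⟩
  rcases hv.mem_or_neg_mem hroot hβ with h | h
  · exact key β h
  · rw [← rootReflection_neg]
    exact key _ h

lemma exists_list_of_mem_closure_rootReflection {S : Finset (E d)} {w : E d ≃ₗᵢ[ℝ] E d}
    (hw : w ∈ Subgroup.closure (rootReflection '' (S : Set (E d)))) :
    ∃ L : List (E d), (∀ σ ∈ L, σ ∈ S) ∧ w = (L.map rootReflection).prod := by
  induction hw using Subgroup.closure_induction with
  | mem x hx =>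
    obtain ⟨σ, hσ, rfl⟩ := hx
    exact ⟨[σ], by simpa using hσ, by simp⟩
  | one => exact ⟨[], by simp, by simp⟩
  | mul x y _ _ hx hy =>
    obtain ⟨L, hL, rfl⟩ := hx
    obtain ⟨L', hL', rfl⟩ := hy
    refine ⟨L ++ L', ?_, by simp⟩
    intro σ hσ
    rcases List.mem_append.1 hσ with h | h
    exacts [hL σ h, hL' σ h]
  | inv x _ hx =>
    obtain ⟨L, hL, rfl⟩ := hx
    refine ⟨L.reverse, fun σ hσ => hL σ (List.mem_reverse.1 hσ), ?_⟩
    rw [List.prod_inv_reverse, List.map_reverse, List.map_map]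
    congr 3

lemma IsSimpleSystem.exists_split (hS : IsSimpleSystem Sp S) {γ : E d} (hγ : γ ∈ Sp)
    (L : List (E d)) (hL : ∀ σ ∈ L, σ ∈ S) (h : (L.map rootReflection).prod γ ∉ Sp) :
    ∃ A σ B, L = A ++ σ :: B ∧ (B.map rootReflection).prod γ = σ := by
  induction L with
  | nil => exact absurd hγ h
  | cons τ T ih =>
    by_cases hT : (T.map rootReflection).prod γ ∈ Sp
    · refine ⟨[], τ, T, rfl, ?_⟩
      by_contra hne
      exact h (hS.reflection_mem τ (hL τ (by simp)) _ hT hne)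
    · obtain ⟨A, σ, B, rfl, hB⟩ := ih (fun σ hσ => hL σ (by simp [hσ])) hT
      exact ⟨τ :: A, σ, B, rfl, hB⟩

lemma IsSimpleSystem.prod_eq_one (hS : IsSimpleSystem Sp S) (hv : PositiveFor Sig Sp v)
    (n : ℕ) (L : List (E d)) (hn : L.length ≤ n) (hL : ∀ σ ∈ L, σ ∈ S)
    (h : ∀ β ∈ Sp, (L.map rootReflection).prod β ∈ Sp) : (L.map rootReflection).prod = 1 := by
  induction n generalizing L with
  | zero => simp [List.length_eq_zero_iff.1 (Nat.le_zero.1 hn)]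
  | succ n ih =>
    rcases List.eq_nil_or_concat L with rfl | ⟨K, τ, rfl⟩
    · simp
    · simp only [List.concat_eq_append, List.mem_append, List.map_append, List.prod_append,
        List.length_append] at *
      have hτ : τ ∈ S := hL τ (by simp)
      have h1 := h τ (hS.subset hτ)
      have h2 : (K.map rootReflection).prod τ ∉ Sp := by
        intro hcon
        refine hv.neg_notMem hcon ?_
        have e : ((K.map rootReflection).prod * (List.map rootReflection [τ]).prod) τ
            = -(K.map rootReflection).prod τ := by
          simp [rootReflection_self]
        rwa [e] at h1
      obtain ⟨A, σ, B, rfl, hB⟩ := hS.exists_split (hS.subset hτ) K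
        (fun σ hσ => hL σ (by simp [hσ])) h2
      have hconj := conj_rootReflection (B.map rootReflection).prod τ
      rw [hB] at hconj
      have e : ((A ++ σ :: B).map rootReflection).prod * (List.map rootReflection [τ]).prod =
          ((A ++ B).map rootReflection).prod := by
        simp only [List.map_append, List.prod_append, List.map_cons, List.prod_cons, List.map_nil,
          List.prod_nil, mul_one]
        rw [mul_assoc, mul_assoc]
        congr 1
        rw [← hconj]
        have : rootReflection τ * rootReflection τ = 1 := rootReflection_mul_self τ
        rw [mul_assoc, mul_assoc, inv_mul_cancel_left, this, mul_one]
      rw [e] at h ⊢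
      refine ih _ ?_ ?_ h
      · simp at hn ⊢
        omega
      · intro σ' hσ'
        rcases List.mem_append.1 hσ' with h' | h' <;> exact hL σ' (by simp [h'])

/-- The Weyl group acts freely on positive systems. -/
lemma PositiveFor.eq_one_of_map_mem (hv : PositiveFor Sig Sp v) (hroot : IsRootSystem Sig)
    {w : E d ≃ₗᵢ[ℝ] E d} (hw : w ∈ weylGroup Sig) (h : ∀ β ∈ Sp, w β ∈ Sp) : w = 1 := by
  obtain ⟨S, hS⟩ := hv.exists_isSimpleSystem hroot
  obtain ⟨L, hL, rfl⟩ := exists_list_of_mem_closure_rootReflection (hS.weylGroup_le hv hroot hw)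
  exact hS.prod_eq_one hv L.length L le_rfl hL h

lemma PositiveFor.inner_apply_le_of_pos [Finite (weylGroup Sig)] (hv : PositiveFor Sig Sp v)
    (hroot : IsRootSystem Sig) {X Y : E d} (hX : ∀ α ∈ Sp, 0 < ⟪α, X⟫) (hY : ∀ α ∈ Sp, 0 < ⟪α, Y⟫)
    (w : weylGroup Sig) : ⟪X, w.1 Y⟫ ≤ ⟪X, Y⟫ := by
  obtain ⟨w₀, hmax⟩ := Finite.exists_max (fun w : weylGroup Sig => ⟪X, w.1 Y⟫)
  have hdom : ∀ α ∈ Sp, 0 ≤ ⟪α, w₀.1 Y⟫ := by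
    intro α hα
    by_contra! hneg
    have h1 := hmax (⟨_, rootReflection_mem_weylGroup ((hv.2 _).1 hα).1⟩ * w₀)
    have e : ((⟨_, rootReflection_mem_weylGroup ((hv.2 _).1 hα).1⟩ * w₀ : weylGroup Sig)).1 Y
      = rootReflection α (w₀.1 Y) := rfl
    simp only [e] at h1
    rw [inner_rootReflection_right, real_inner_comm α X] at h1
    have h2 : 2 * ⟪α, w₀.1 Y⟫ / ⟪α, α⟫ < 0 :=
      div_neg_of_neg_of_pos (by linarith) (real_inner_self_pos.2 (hv.ne_zero hα))
    have := mul_neg_of_neg_of_pos h2 (hX α hα)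
    linarith
  have h1 : w₀.1 = 1 := by
    refine hv.eq_one_of_map_mem hroot w₀.2 fun β hβ => ?_
    have hm := (weylGroup_map_mem_iff hroot w₀.2 β).2 ((hv.2 _).1 hβ).1
    refine (hv.mem_or_neg_mem hroot hm).resolve_right fun hcon => ?_
    have := hdom _ hcon
    rw [inner_neg_left, w₀.1.inner_map_map] at this
    linarith [hY β hβ]
  have := hmax w
  rw [h1] at this
  exact this

lemma PositiveFor.inner_apply_le [Finite (weylGroup Sig)] (hv : PositiveFor Sig Sp v)
    (hroot : IsRootSystem Sig) {X Y : E d} (hX : ∀ α ∈ Sp, 0 ≤ ⟪α, X⟫) (hY : ∀ α ∈ Sp, 0 ≤ ⟪α, Y⟫)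
    (w : weylGroup Sig) : ⟪X, w.1 Y⟫ ≤ ⟪X, Y⟫ := by
  have hpos : ∀ Z : E d, (∀ α ∈ Sp, 0 ≤ ⟪α, Z⟫) → ∀ ε : ℝ, 0 < ε →
      ∀ α ∈ Sp, 0 < ⟪α, Z + ε • v⟫ := by
    intro Z hZ ε hε α hα
    rw [inner_add_right, inner_smul_right]
    have := mul_pos hε ((hv.2 _).1 hα).2
    linarith [hZ α hα]
  have c1 : Continuous fun ε : ℝ => ⟪X + ε • v, w.1 (Y + ε • v)⟫ := by fun_prop
  have c2 : Continuous fun ε : ℝ => ⟪X + ε • v, Y + ε • v⟫ := by fun_prop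
  have := le_of_tendsto_of_tendsto (b := nhdsWithin (0 : ℝ) (Set.Ioi 0))
    ((c1.tendsto 0).mono_left nhdsWithin_le_nhds) ((c2.tendsto 0).mono_left nhdsWithin_le_nhds) (by
      filter_upwards [self_mem_nhdsWithin] with ε hε
      exact hv.inner_apply_le_of_pos hroot (hpos X hX ε hε) (hpos Y hY ε hε) w)
  simpa using this

lemma piP_rootReflection (hS : IsSimpleSystem Sp S) (hv : PositiveFor Sig Sp v) {σ : E d}
    (hσ : σ ∈ S) (z : E d) : piP Sp (rootReflection σ z) = -piP Sp z := by
  unfold piP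
  rw [← Finset.mul_prod_erase _ _ (hS.subset hσ), ← Finset.mul_prod_erase _ _ (hS.subset hσ),
    ← inner_rootReflection_left, rootReflection_self, inner_neg_left, neg_mul]
  congr 2
  have hmem : ∀ β ∈ Sp.erase σ, rootReflection σ β ∈ Sp.erase σ := by
    intro β hβ
    rw [mem_erase] at hβ ⊢
    refine ⟨fun h => ?_, hS.reflection_mem σ hσ β hβ.2 hβ.1⟩
    have : β = -σ := by
      rw [← rootReflection_self, ← rootReflection_involutive σ β, h]
    exact hv.neg_notMem (hS.subset hσ) (this ▸ hβ.2)
  refine Finset.prod_nbij' (rootReflection σ) (rootReflection σ) hmem hmem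
    (fun β _ => rootReflection_involutive _ _) (fun β _ => rootReflection_involutive _ _) ?_
  intro β _
  rw [inner_rootReflection_left]

lemma PositiveFor.piP_map (hv : PositiveFor Sig Sp v) (hroot : IsRootSystem Sig)
    {w : E d ≃ₗᵢ[ℝ] E d} (hw : w ∈ weylGroup Sig) (z : E d) :
    piP Sp (w z) = dsign w * piP Sp z := by
  obtain ⟨S, hS⟩ := hv.exists_isSimpleSystem hroot
  obtain ⟨L, hL, rfl⟩ := exists_list_of_mem_closure_rootReflection (hS.weylGroup_le hv hroot hw)
  clear hw
  induction L with
  | nil => simp [dsign_one]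
  | cons σ L ih =>
    have hσ : σ ∈ S := hL σ (by simp)
    rw [List.map_cons, List.prod_cons, LinearIsometryEquiv.coe_mul, Function.comp_apply,
      piP_rootReflection hS hv hσ, ih (fun τ hτ => hL τ (by simp [hτ])), dsign_mul,
      dsign_rootReflection (hv.ne_zero (hS.subset hσ))]
    ring

lemma exists_sign_piP_map {T : Finset (E d)} {w : E d ≃ₗᵢ[ℝ] E d}
    (hneg : ∀ α ∈ T, -α ∉ T) (h : ∀ α ∈ T, w⁻¹ α ∈ T ∨ -w⁻¹ α ∈ T) :
    ∃ ε : ℝ, ∀ z, piP T (w z) = ε * piP T z := by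
  let s : E d → ℝ := fun α => if w⁻¹ α ∈ T then 1 else -1
  have hs : ∀ α, s α = 1 ∨ s α = -1 := fun α => ite_eq_or_eq _ _ _
  have hs2 : ∀ α, s α * s α = 1 := fun α => by rcases hs α with h | h <;> simp [h]
  let f : E d → E d := fun α => s α • w⁻¹ α
  have hf : ∀ α ∈ T, f α ∈ T := by
    intro α hα
    by_cases h' : w⁻¹ α ∈ T
    · simpa only [f, s, if_pos h', one_smul] using h'
    · simpa only [f, s, if_neg h', neg_smul, one_smul] using (h α hα).resolve_left h'
  have hinj : Set.InjOn f (T : Set (E d)) := by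
    intro α hα β hβ hab
    have h1 : w⁻¹ (s α • α) = w⁻¹ (s β • β) := by simpa [f] using hab
    have h2 := w⁻¹.injective h1
    rcases hs α with ha | ha <;> rcases hs β with hb | hb <;> rw [ha, hb] at h2 <;>
      simp at h2
    · exact h2
    · exact absurd (h2 ▸ hα) (hneg β hβ)
    · exact absurd (h2 ▸ hβ) (hneg α hα)
    · exact h2
  have himg : T.image f = T := by
    refine Finset.eq_of_subset_of_card_le (Finset.image_subset_iff.2 hf) ?_
    rw [Finset.card_image_of_injOn hinj]
  refine ⟨∏ α ∈ T, s α, fun z => ?_⟩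
  have h1 : piP T z = ∏ α ∈ T, ⟪f α, z⟫ := by
    conv_lhs => rw [piP, ← himg, Finset.prod_image hinj]
  rw [h1, ← Finset.prod_mul_distrib]
  refine Finset.prod_congr rfl fun α _ => ?_
  rw [real_inner_smul_left, ← mul_assoc, hs2, one_mul, inner_inv_apply_left]

lemma PositiveFor.piP_pos (hv : PositiveFor Sig Sp v) {T : Finset (E d)} (hT : T ⊆ Sp) :
    0 < piP T v :=
  Finset.prod_pos fun _ hα => ((hv.2 _).1 (hT hα)).2

lemma piP_filter_mul (T : Finset (E d)) (p : E d → Prop) (z : E d) :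
    piP (T.filter p) z * piP (T.filter fun α => ¬ p α) z = piP T z :=
  Finset.prod_filter_mul_prod_filter_not T p _

lemma PositiveFor.piP_map_of_fixed (hv : PositiveFor Sig Sp v) (hroot : IsRootSystem Sig)
    {w : E d ≃ₗᵢ[ℝ] E d} (hw : w ∈ weylGroup Sig) {q : E d} (hq : w q = q) (z : E d) :
    piP (Sp.filter fun α => ⟪α, q⟫ = 0) (w z) =
      dsign w * piP (Sp.filter fun α => ⟪α, q⟫ = 0) z := by
  have hmem : ∀ α ∈ Sp, w⁻¹ α ∈ Sp ∨ -w⁻¹ α ∈ Sp := fun α hα =>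
    hv.mem_or_neg_mem hroot
      ((weylGroup_map_mem_iff hroot (inv_mem hw) α).2 ((hv.2 _).1 hα).1)
  have hin : ∀ α, ⟪w⁻¹ α, q⟫ = ⟪α, q⟫ := fun α => by rw [inner_inv_apply_left, hq]
  obtain ⟨a, ha⟩ := exists_sign_piP_map (T := Sp.filter fun α => ⟪α, q⟫ = 0) (w := w)
    (fun α hα h => hv.neg_notMem (mem_filter.1 hα).1 (mem_filter.1 h).1) (fun α hα => by
      simp only [mem_filter, inner_neg_left, hin, neg_eq_zero] at hα ⊢
      simpa [hα.2] using hmem α hα.1)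
  obtain ⟨b, hb⟩ := exists_sign_piP_map (T := Sp.filter fun α => ¬ ⟪α, q⟫ = 0) (w := w)
    (fun α hα h => hv.neg_notMem (mem_filter.1 hα).1 (mem_filter.1 h).1) (fun α hα => by
      simp only [mem_filter, inner_neg_left, hin, neg_eq_zero] at hα ⊢
      simpa [hα.2] using hmem α hα.1)
  have hb1 : b = 1 := by
    have h1 := hb q
    rw [hq] at h1
    have h2 : piP (Sp.filter fun α => ¬ ⟪α, q⟫ = 0) q ≠ 0 :=
      Finset.prod_ne_zero_iff.2 fun α hα => (mem_filter.1 hα).2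
    exact mul_right_cancel₀ h2 (by rw [← h1, one_mul])
  have h1 := hv.piP_map hroot hw v
  rw [← piP_filter_mul Sp (fun α => ⟪α, q⟫ = 0), ← piP_filter_mul Sp (fun α => ⟪α, q⟫ = 0), ha, hb,
    hb1, one_mul, mul_assoc] at h1
  have h3 := mul_right_cancel₀ (mul_pos (hv.piP_pos (filter_subset _ _))
    (hv.piP_pos (filter_subset _ _))).ne' h1
  rw [ha, h3]

end WeylAction

section Taylor
open Polynomial

lemma coeff_eq_of_tendsto_eval_div_pow (k : ℕ) (p : ℝ[X]) {L : ℝ}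
    (h : Filter.Tendsto (fun δ => p.eval δ / δ ^ k) (nhdsWithin 0 {0}ᶜ) (nhds L)) :
    p.coeff k = L := by
  have hp : ∀ p : ℝ[X], Filter.Tendsto (fun δ => p.eval δ) (nhdsWithin 0 {0}ᶜ)
      (nhds (p.coeff 0)) := fun p => by
    rw [coeff_zero_eq_eval_zero]
    exact (p.continuous.tendsto 0).mono_left nhdsWithin_le_nhds
  induction k generalizing p with
  | zero => exact tendsto_nhds_unique (hp p) (by simpa using h)
  | succ k ih =>
    have h0 : p.coeff 0 = 0 := by
      refine tendsto_nhds_unique (hp p) ?_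
      have h1 : Filter.Tendsto (fun δ : ℝ => δ ^ (k + 1)) (nhdsWithin 0 {0}ᶜ) (nhds 0) := by
        have : Continuous fun δ : ℝ => δ ^ (k + 1) := by fun_prop
        simpa using (this.tendsto 0).mono_left nhdsWithin_le_nhds
      have h2 := h.mul h1
      rw [mul_zero] at h2
      refine h2.congr' ?_
      filter_upwards [self_mem_nhdsWithin] with δ hδ
      exact div_mul_cancel₀ _ (pow_ne_zero _ hδ)
    rw [← coeff_divX]
    refine ih _ (h.congr' ?_)
    filter_upwards [self_mem_nhdsWithin] with δ hδ
    have hδ' : δ ≠ 0 := hδ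
    conv_lhs => rw [← divX_mul_X_add p, h0]
    simp only [map_zero, add_zero, eval_mul, eval_X]
    field_simp
    ring

lemma eq_sum_coeff_of_tendsto_div_pow {ι : Type*} (s : Finset ι) (Q : ι → ℝ[X]) (b : ι → ℝ)
    (k : ℕ) {L : ℝ}
    (h : Filter.Tendsto (fun δ => (∑ i ∈ s, (Q i).eval δ * Real.exp (b i * δ)) / δ ^ k)
      (nhdsWithin 0 {0}ᶜ) (nhds L)) :
    L = ∑ i ∈ s, ∑ j ∈ range (k + 1),
      (Q i).coeff j * (b i ^ (k - j) / (k - j).factorial) := by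
  let T : ι → ℝ[X] := fun i => ∑ n ∈ range (k + 1), C (b i ^ n / n.factorial) * X ^ n
  have hT : ∀ i δ, (T i).eval δ = ∑ n ∈ range (k + 1), (b i * δ) ^ n / n.factorial := by
    intro i δ
    simp only [T, eval_finsetSum, eval_mul, eval_C, eval_pow, eval_X, mul_pow]
    exact sum_congr rfl fun n _ => by ring
  have hrem : ∀ i, Filter.Tendsto
      (fun δ => (Q i).eval δ * ((Real.exp (b i * δ) - (T i).eval δ) / δ ^ k))
      (nhdsWithin 0 {0}ᶜ) (nhds 0) := by
    intro i
    have h1 : (fun δ : ℝ => Real.exp (b i * δ) - (T i).eval δ) =o[nhds 0] (fun δ => δ ^ k) := by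
      have hb : Filter.Tendsto (fun δ : ℝ => b i * δ) (nhds 0) (nhds 0) := by
        have : Continuous fun δ : ℝ => b i * δ := by fun_prop
        simpa using this.tendsto 0
      have h2 := (Real.exp_sub_sum_range_succ_isLittleO_pow k).comp_tendsto hb
      simp only [Function.comp_def] at h2
      simp only [hT]
      refine h2.trans_isBigO ?_
      simp only [mul_pow]
      exact Asymptotics.isBigO_const_mul_self _ _ _
    have h3 := h1.tendsto_div_nhds_zero.mono_left (nhdsWithin_le_nhds (s := {0}ᶜ))
    have h4 := (((Q i).continuous.tendsto 0).mono_left (nhdsWithin_le_nhds (s := {0}ᶜ))).mul h3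
    simpa using h4
  have h5 := h.sub (tendsto_finsetSum s fun i _ => hrem i)
  rw [sum_const_zero, sub_zero] at h5
  have h6 := coeff_eq_of_tendsto_eval_div_pow k (∑ i ∈ s, Q i * T i) (h5.congr fun δ => by
    rw [sum_div, ← sum_sub_distrib, eval_finsetSum, sum_div]
    refine sum_congr rfl fun i _ => ?_
    rw [eval_mul]
    ring)
  rw [← h6, finsetSum_coeff]
  refine sum_congr rfl fun i _ => ?_
  rw [coeff_mul, Finset.Nat.sum_antidiagonal_eq_sum_range_succ
    (fun a c => (Q i).coeff a * (T i).coeff c)]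
  refine sum_congr rfl fun j hj => ?_
  congr 1
  simp only [T, finsetSum_coeff, coeff_C_mul_X_pow]
  rw [sum_ite_eq, if_pos]
  simp only [mem_range]
  omega

end Taylor

section Density

lemma dense_inner_ne_zero {d : ℕ} {t : E d} (ht : t ≠ 0) : Dense {x : E d | ⟪t, x⟫ ≠ 0} := by
  intro x
  by_cases hx : ⟪t, x⟫ = 0
  · have hc : Continuous fun ε : ℝ => x + ε • t := by fun_prop
    have h1 : Filter.Tendsto (fun ε : ℝ => x + ε • t) (nhdsWithin 0 {0}ᶜ) (nhds x) := by
      simpa using (hc.tendsto 0).mono_left (nhdsWithin_le_nhds (s := {0}ᶜ))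
    refine mem_closure_of_tendsto h1 ?_
    filter_upwards [self_mem_nhdsWithin] with ε hε
    simp only [inner_add_right, hx, inner_smul_right, zero_add]
    exact mul_ne_zero hε (real_inner_self_pos.2 ht).ne'
  · exact subset_closure hx

lemma dense_forall_inner_ne_zero {d : ℕ} (T : Finset (E d)) (hT : ∀ t ∈ T, t ≠ 0) :
    Dense {x : E d | ∀ t ∈ T, ⟪t, x⟫ ≠ 0} := by
  induction T using Finset.induction_on with
  | empty => simp
  | insert a s ha ih =>
    have h1 := dense_inner_ne_zero (hT a (by simp))
    have h2 := ih fun t ht => hT t (by simp [ht])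
    have ho : IsOpen {x : E d | ⟪a, x⟫ ≠ 0} := isOpen_ne_fun (by fun_prop) (by fun_prop)
    refine (h1.inter_of_isOpen_left h2 ho).mono ?_
    rintro x ⟨hx1, hx2⟩ t ht
    rcases mem_insert.1 ht with rfl | ht
    exacts [hx1, hx2 t ht]

/-- Points off all hyperplanes whose line in direction `v` meets them at distinct times. -/
def genericSet {d : ℕ} (Sp : Finset (E d)) (v : E d) : Set (E d) :=
  {x | (∀ α ∈ Sp, ⟪α, x⟫ ≠ 0) ∧
    ∀ α ∈ Sp, ∀ β ∈ Sp, ⟪α, x⟫ / ⟪α, v⟫ = ⟪β, x⟫ / ⟪β, v⟫ → α = β}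

lemma PositiveFor.dense_genericSet {d : ℕ} {Sig Sp : Finset (E d)} {v : E d}
    (hv : PositiveFor Sig Sp v) (hroot : IsRootSystem Sig) : Dense (genericSet Sp v) := by
  let T : Finset (E d) := Sp ∪ ((Sp ×ˢ Sp).filter fun p => p.1 ≠ p.2).image
    fun p => ⟪p.2, v⟫ • p.1 - ⟪p.1, v⟫ • p.2
  have hpos : ∀ α ∈ Sp, 0 < ⟪α, v⟫ := fun α hα => ((hv.2 α).1 hα).2
  refine (dense_forall_inner_ne_zero T ?_).mono ?_
  · intro t ht
    rcases mem_union.1 ht with ht | ht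
    · exact hv.ne_zero ht
    · obtain ⟨⟨α, β⟩, hp, rfl⟩ := mem_image.1 ht
      simp only [mem_filter, mem_product] at hp
      obtain ⟨⟨hα, hβ⟩, hne⟩ := hp
      intro h
      simp only at h
      have h1 : (⟪α, v⟫ / ⟪β, v⟫) • β = α := by
        rw [div_eq_inv_mul, mul_smul, ← sub_eq_zero.1 h, smul_smul,
          inv_mul_cancel₀ (hpos β hβ).ne', one_smul]
      have h2 := hv.eq_of_smul hroot hβ (c := ⟪α, v⟫ / ⟪β, v⟫) (by rwa [h1])
      rw [h2, one_smul] at h1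
      exact hne h1.symm
  · intro x hx
    refine ⟨fun α hα => hx α (mem_union_left _ hα), fun α hα β hβ h => ?_⟩
    by_contra hne
    refine hx (⟪β, v⟫ • α - ⟪α, v⟫ • β) (mem_union_right _ (mem_image.2 ⟨(α, β), ?_, rfl⟩)) ?_
    · simp only [mem_filter, mem_product]
      exact ⟨⟨hα, hβ⟩, hne⟩
    · rw [div_eq_div_iff (hpos α hα).ne' (hpos β hβ).ne'] at h
      rw [inner_sub_left, real_inner_smul_left, real_inner_smul_left]
      linarith

end Density

section DerivativeConstant
variable {d : ℕ} {Sig Sp : Finset (E d)} {v : E d}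

lemma Dop_sum_pow {ι : Type*} (s : Finset ι) (c : ι → ℝ) (y : ι → E d) (n : ℕ)
    (L : List (E d)) :
    Dop L (fun z => ∑ i ∈ s, c i * ⟪z, y i⟫ ^ n) =
      fun z => ∑ i ∈ s, c i * (n.descFactorial L.length * (L.map fun a => ⟪a, y i⟫).prod) *
        ⟪z, y i⟫ ^ (n - L.length) := by
  induction L with
  | nil => simp [Dop]
  | cons a L ih =>
    funext x
    rw [Dop, ih]
    have h : HasFDerivAt (fun z : E d => ∑ i ∈ s, c i * (n.descFactorial L.length *
        (L.map fun a => ⟪a, y i⟫).prod) * ⟪z, y i⟫ ^ (n - L.length))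
        (∑ i ∈ s, (c i * (n.descFactorial L.length * (L.map fun a => ⟪a, y i⟫).prod)) •
          (((n - L.length : ℕ) * ⟪x, y i⟫ ^ (n - L.length - 1)) • innerSL ℝ (y i))) x := by
      refine HasFDerivAt.fun_sum fun i _ => HasFDerivAt.const_mul ?_ _
      have h1 : HasFDerivAt (fun z : E d => ⟪z, y i⟫) (innerSL ℝ (y i)) x := by
        have := (innerSL ℝ (y i)).hasFDerivAt (x := x)
        refine this.congr_of_eventuallyEq (Filter.Eventually.of_forall fun z => ?_)
        simp [real_inner_comm]
      have := h1.pow (n - L.length)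
      simpa using this
    change fderiv ℝ _ x a = _
    rw [h.fderiv, _root_.sum_apply]
    refine sum_congr rfl fun i _ => ?_
    simp only [_root_.smul_apply, innerSL_apply_apply, smul_eq_mul, List.length_cons,
      Nat.descFactorial_succ, Nat.cast_mul, List.map_cons, List.prod_cons, Nat.sub_sub,
      real_inner_comm a]
    ring

lemma Dop_const_mul (L : List (E d)) (c : ℝ) (f : E d → ℝ) :
    Dop L (fun z => c * f z) = fun z => c * Dop L f z := by
  induction L with
  | nil => rfl
  | cons a L ih =>
    funext x
    rw [Dop, ih, Dop]
    have : (fun z => c * Dop L f z) = c • Dop L f := rfl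
    rw [this, fderiv_const_smul_field]
    rfl

lemma alternating_sum_eq_zero {M : Type*} [AddCommGroup M] [Module ℝ M]
    {H : Finset (weylGroup Sig)} {α : E d} (h0 : α ≠ 0) {s : weylGroup Sig}
    (hs : s.1 = rootReflection α) (hH : ∀ w ∈ H, s * w ∈ H)
    (f : (E d ≃ₗᵢ[ℝ] E d) → M) (hf : ∀ w, f (rootReflection α * w) = f w) :
    ∑ w ∈ H, dsign w.1 • f w.1 = 0 := by
  have hss : s * s = 1 := Subtype.ext (by
    rw [Subgroup.coe_mul, hs, rootReflection_mul_self, Subgroup.coe_one])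
  have hinv : ∀ w : weylGroup Sig, s * (s * w) = w := fun w => by rw [← mul_assoc, hss, one_mul]
  have h : ∑ w ∈ H, dsign w.1 • f w.1 = ∑ w ∈ H, -(dsign w.1 • f w.1) := by
    refine Finset.sum_nbij' (fun w => s * w) (fun w => s * w) hH hH
      (fun w _ => hinv w) (fun w _ => hinv w) ?_
    intro w _
    rw [Subgroup.coe_mul, hs, hf, dsign_mul, dsign_rootReflection h0, neg_one_mul, neg_smul,
      neg_neg]
  rw [sum_neg_distrib] at h
  have h2 : (2 : ℝ) • ∑ w ∈ H, dsign w.1 • f w.1 = 0 := by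
    rw [two_smul]
    nth_rewrite 1 [h]
    exact neg_add_cancel _
  exact (smul_eq_zero_iff_right two_ne_zero).1 h2

end DerivativeConstant

section AlternatingPower
open Polynomial

lemma eval_zero_mul_eq_of_vanish {ι κ : Type*} (S : Finset ι) (H : Finset κ) (a b : ι → ℝ)
    (c p q : κ → ℝ) (hb : ∀ i ∈ S, b i ≠ 0)
    (hinj : ∀ i ∈ S, ∀ j ∈ S, a i / b i = a j / b j → i = j)
    (hvan : ∀ i ∈ S, ∑ w ∈ H, c w * (p w + -(a i / b i) * q w) ^ #S = 0) :
    (∏ i ∈ S, b i) * ∑ w ∈ H, c w * p w ^ #S =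
      (∑ w ∈ H, c w * q w ^ #S) * ∏ i ∈ S, a i := by
  let P : ℝ[X] := ∑ w ∈ H, C (c w) * (C (q w) * X + C (p w)) ^ #S
  let Q : ℝ[X] := ∏ i ∈ S, (C (b i) * X + C (a i))
  let D : ℝ[X] := C (∏ i ∈ S, b i) * P - C (∑ w ∈ H, c w * q w ^ #S) * Q
  have hlin : ∀ r s : ℝ, (C r * X + C s).natDegree ≤ 1 := fun r s => natDegree_linear_le
  have hdeg : D.degree < #S := by
    rw [degree_lt_iff_coeff_zero]
    have hpow : ∀ r s : ℝ, ((C r * X + C s) ^ #S).natDegree ≤ #S := fun r s =>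
      (natDegree_pow_le_of_le _ (hlin r s)).trans (by simp)
    have hQ : Q.natDegree ≤ #S := by
      refine (natDegree_prod_le _ _).trans ((sum_le_sum fun i _ => hlin _ _).trans (by simp))
    intro m hm
    rcases hm.lt_or_eq with hm | hm
    · have h1 : P.coeff m = 0 := by
        simp only [P, finsetSum_coeff, coeff_C_mul]
        exact sum_eq_zero fun w _ => by
          rw [coeff_eq_zero_of_natDegree_lt ((hpow _ _).trans_lt hm), mul_zero]
      have h2 : Q.coeff m = 0 := coeff_eq_zero_of_natDegree_lt (hQ.trans_lt hm)
      simp [D, -map_prod, -map_sum, h1, h2]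
    · subst hm
      have h1 : P.coeff #S = ∑ w ∈ H, c w * q w ^ #S := by
        simp only [P, finsetSum_coeff, coeff_C_mul]
        refine sum_congr rfl fun w _ => ?_
        have := coeff_pow_of_natDegree_le (m := #S) (hlin (q w) (p w))
        rw [mul_one] at this
        rw [this]
        simp
      have h2 : Q.coeff #S = ∏ i ∈ S, b i := by
        have := coeff_prod_of_natDegree_le S (fun i => C (b i) * X + C (a i)) 1
          fun i _ => hlin _ _
        rw [mul_one] at this
        simp only [Q]
        rw [this]
        exact prod_congr rfl fun i _ => by simp
      simp only [D, coeff_sub, coeff_C_mul, h1, h2]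
      ring
  have hD : D = 0 := by
    refine Polynomial.eq_zero_of_degree_lt_of_eval_index_eq_zero (s := S)
      (v := fun i => -(a i / b i)) ?_ hdeg ?_
    · intro i hi j hj h
      exact hinj i hi j hj (neg_injective h)
    · intro i hi
      have h1 : P.eval (-(a i / b i)) = 0 := by
        rw [← hvan i hi]
        simp only [P, eval_finsetSum, eval_mul, eval_C, eval_pow, eval_add, eval_X]
        exact sum_congr rfl fun w _ => by ring
      have h2 : Q.eval (-(a i / b i)) = 0 := by
        simp only [Q, eval_prod]
        refine prod_eq_zero hi ?_
        have := hb i hi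
        simp only [eval_add, eval_mul, eval_C, eval_X]
        field_simp
        ring
      simp only [D, eval_sub, eval_mul, h1, h2, mul_zero, sub_zero]
  have h0 : D.eval 0 = 0 := by rw [hD, eval_zero]
  simp only [D, P, Q, eval_sub, eval_mul, eval_C, eval_finsetSum, eval_prod, eval_pow, eval_add,
    eval_X, mul_zero, zero_add] at h0
  exact sub_eq_zero.1 h0

variable {d : ℕ} {Sig Sp : Finset (E d)} {v : E d}

lemma continuous_piP (S : Finset (E d)) : Continuous (piP S) :=
  continuous_finsetProd _ fun α _ => by fun_prop

/-- `H` consists of elements fixing `q` and is stable under the reflections fixing `q`. -/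
structure StabLike (Sig Sp : Finset (E d)) (H : Finset (weylGroup Sig)) (q : E d) : Prop where
  fixed : ∀ w ∈ H, w.1 q = q
  reflection_mul_mem : ∀ α ∈ Sp, ⟪α, q⟫ = 0 → ∀ s : weylGroup Sig, s.1 = rootReflection α →
    ∀ w ∈ H, s * w ∈ H

lemma sum_inner_pow_eq_zero {H : Finset (weylGroup Sig)} {q : E d}
    (hH : StabLike Sig Sp H q) (hv : PositiveFor Sig Sp v) {α : E d} (hα : α ∈ Sp)
    (hαq : ⟪α, q⟫ = 0) {z : E d} (hz : ⟪α, z⟫ = 0) (y : E d) (k : ℕ) :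
    ∑ w ∈ H, dsign w.1 * ⟪z, w.1 y⟫ ^ k = 0 := by
  have hSig := ((hv.2 α).1 hα).1
  refine alternating_sum_eq_zero (M := ℝ) (hv.ne_zero hα)
    (s := ⟨rootReflection α, rootReflection_mem_weylGroup hSig⟩) rfl
    (hH.reflection_mul_mem α hα hαq _ rfl) (fun w => ⟪z, w y⟫ ^ k) fun w => ?_
  rw [LinearIsometryEquiv.coe_mul, Function.comp_apply, ← inner_rootReflection_left,
    rootReflection_eq_self hz]

lemma PositiveFor.piP_mul_sum_pow (hv : PositiveFor Sig Sp v) (hroot : IsRootSystem Sig)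
    {S : Finset (E d)} {H : Finset (weylGroup Sig)} {q : E d} (hH : StabLike Sig Sp H q)
    (hS : S = Sp.filter fun α => ⟪α, q⟫ = 0) (z y : E d) :
    piP S v * ∑ w ∈ H, dsign w.1 * ⟪z, w.1 y⟫ ^ #S =
      (∑ w ∈ H, dsign w.1 * ⟪v, w.1 y⟫ ^ #S) * piP S z := by
  have hSSp : S ⊆ Sp := hS ▸ filter_subset _ _
  have hc : ∀ z ∈ genericSet Sp v, piP S v * ∑ w ∈ H, dsign w.1 * ⟪z, w.1 y⟫ ^ #S =
      (∑ w ∈ H, dsign w.1 * ⟪v, w.1 y⟫ ^ #S) * piP S z := by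
    intro z hz
    refine eval_zero_mul_eq_of_vanish S H (fun α => ⟪α, z⟫) (fun α => ⟪α, v⟫) _ _ _
      (fun α hα => ((hv.2 α).1 (hSSp hα)).2.ne')
      (fun α hα β hβ => hz.2 α (hSSp hα) β (hSSp hβ)) fun α hα => ?_
    have hα' := ((hv.2 α).1 (hSSp hα)).2.ne'
    have hαq : ⟪α, q⟫ = 0 := by rw [hS] at hα; exact (mem_filter.1 hα).2
    rw [← sum_inner_pow_eq_zero hH hv (hSSp hα) hαq
      (z := z + -(⟪α, z⟫ / ⟪α, v⟫) • v) ?_ y #S]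
    · exact sum_congr rfl fun w _ => by rw [inner_add_left, real_inner_smul_left]
    · rw [inner_add_right, inner_smul_right]
      field_simp
      ring
  have hfun := Continuous.ext_on (hv.dense_genericSet hroot)
    (f := fun z => piP S v * ∑ w ∈ H, dsign w.1 * ⟪z, w.1 y⟫ ^ #S)
    (g := fun z => (∑ w ∈ H, dsign w.1 * ⟪v, w.1 y⟫ ^ #S) * piP S z)
    (by fun_prop) (continuous_const.mul (continuous_piP S)) hc
  exact congrFun hfun z

lemma PositiveFor.cConst_relation (hv : PositiveFor Sig Sp v) (hroot : IsRootSystem Sig)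
    {S : Finset (E d)} {H : Finset (weylGroup Sig)} {q : E d} (hH : StabLike Sig Sp H q)
    (hS : S = Sp.filter fun α => ⟪α, q⟫ = 0) (y : E d) :
    (∑ w ∈ H, dsign w.1 * ⟪v, w.1 y⟫ ^ #S) * cConst S =
      piP S v * ((#S).factorial * #H * piP S y) := by
  have h1 : (fun z => piP S v * ∑ w ∈ H, dsign w.1 * ⟪z, w.1 y⟫ ^ #S) =
      fun z => (∑ w ∈ H, dsign w.1 * ⟪v, w.1 y⟫ ^ #S) * piP S z :=
    funext fun z => hv.piP_mul_sum_pow hroot hH hS z y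
  have h2 := congrFun (congrArg (Dop S.toList) h1) 0
  rw [Dop_const_mul, Dop_const_mul, Dop_sum_pow] at h2
  simp only [Finset.length_toList, Nat.descFactorial_self, Nat.sub_self, pow_zero, mul_one,
    Finset.prod_map_toList] at h2
  rw [cConst, ← h2]
  congr 1
  have h3 : ∀ w ∈ H, dsign w.1 * ((#S).factorial * ∏ α ∈ S, ⟪α, w.1 y⟫) =
      (#S).factorial * piP S y := by
    intro w hw
    have h4 := hv.piP_map_of_fixed hroot w.2 (hH.fixed w hw) y
    rw [← hS] at h4
    change dsign w.1 * ((#S).factorial * piP S (w.1 y)) = _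
    rw [h4]
    linear_combination ((#S).factorial * piP S y) * dsign_mul_self hroot.1 w.2
  rw [sum_congr rfl h3, sum_const, nsmul_eq_mul]
  ring

lemma PositiveFor.cConst_ne_zero (hv : PositiveFor Sig Sp v) (hroot : IsRootSystem Sig)
    {S : Finset (E d)} {H : Finset (weylGroup Sig)} {q : E d} (hH : StabLike Sig Sp H q)
    (hS : S = Sp.filter fun α => ⟪α, q⟫ = 0) (hne : H.Nonempty) : cConst S ≠ 0 := by
  intro h
  have h1 := hv.cConst_relation hroot hH hS v
  have h2 := hv.piP_pos (hS ▸ filter_subset _ _ : S ⊆ Sp)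
  have h3 : (0 : ℝ) < #H := by exact_mod_cast hne.card_pos
  have h4 : (0 : ℝ) < (#S).factorial := by exact_mod_cast Nat.factorial_pos _
  rw [h, mul_zero] at h1
  exact (mul_pos h2 (mul_pos (mul_pos h4 h3) h2)).ne h1

lemma PositiveFor.cConst_mul_sum_pow (hv : PositiveFor Sig Sp v) (hroot : IsRootSystem Sig)
    {S : Finset (E d)} {H : Finset (weylGroup Sig)} {q : E d} (hH : StabLike Sig Sp H q)
    (hS : S = Sp.filter fun α => ⟪α, q⟫ = 0) (z y : E d) :
    cConst S * ∑ w ∈ H, dsign w.1 * ⟪z, w.1 y⟫ ^ #S =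
      (#S).factorial * #H * piP S z * piP S y := by
  have h1 := hv.piP_mul_sum_pow hroot hH hS z y
  have h2 := hv.cConst_relation hroot hH hS y
  have h3 := hv.piP_pos (hS ▸ filter_subset _ _ : S ⊆ Sp)
  refine mul_left_cancel₀ h3.ne' ?_
  linear_combination cConst S * h1 + piP S z * h2

end AlternatingPower

section CircleQuotient

lemma exists_differentiable_factor {ι : Type*} (S : Finset ι) (a b : ι → ℝ)
    (hb : ∀ i ∈ S, b i ≠ 0) (hinj : ∀ i ∈ S, ∀ j ∈ S, a i / b i = a j / b j → i = j)
    (f : ℂ → ℂ) (hf : Differentiable ℂ f) (hvan : ∀ i ∈ S, f ((-(a i / b i) : ℝ) : ℂ) = 0) :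
    ∃ h : ℂ → ℂ, Differentiable ℂ h ∧ ∀ z, f z = (∏ i ∈ S, ((a i : ℂ) + z * b i)) * h z := by
  induction S using Finset.induction_on generalizing f with
  | empty => exact ⟨f, hf, by simp⟩
  | insert j S hj ih =>
    set c : ℂ := ((-(a j / b j) : ℝ) : ℂ) with hc
    have hbj : (b j : ℂ) ≠ 0 := by exact_mod_cast hb j (by simp)
    have hd : Differentiable ℂ (dslope f c) := by
      rw [← differentiableOn_univ, Complex.differentiableOn_dslope Filter.univ_mem,
        differentiableOn_univ]
      exact hf
    have hfac : ∀ z, (z - c) * dslope f c z = f z := fun z => by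
      have := sub_smul_dslope f c z
      rwa [hvan j (by simp), sub_zero, smul_eq_mul] at this
    obtain ⟨h, hh, hfh⟩ := ih (fun i hi => hb i (by simp [hi]))
      (fun i hi k hk => hinj i (by simp [hi]) k (by simp [hk])) (dslope f c) hd fun i hi => by
        have h1 := hfac ((-(a i / b i) : ℝ) : ℂ)
        rw [hvan i (by simp [hi])] at h1
        refine (mul_eq_zero.1 h1).resolve_left ?_
        rw [hc, sub_eq_zero]
        intro h2
        have h3 := hinj i (by simp [hi]) j (by simp) (neg_injective (Complex.ofReal_injective h2))
        exact hj (h3 ▸ hi)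
    refine ⟨fun z => (b j : ℂ)⁻¹ * h z, by fun_prop, fun z => ?_⟩
    rw [← hfac z, hfh z, prod_insert hj, hc]
    push_cast
    field_simp
    ring

lemma add_circle_mul_ne_zero {a b R : ℝ} {z : ℂ} (hb : 0 < b) (hR : |a| / b < R)
    (hz : ‖z‖ = R) : (a : ℂ) + z * b ≠ 0 := by
  intro h
  have h1 : z * b = ((-a : ℝ) : ℂ) := by push_cast; linear_combination h
  have h2 := congrArg norm h1
  rw [norm_mul, hz, Complex.norm_real, Complex.norm_real, Real.norm_eq_abs, Real.norm_eq_abs,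
    abs_of_pos hb, abs_neg] at h2
  rw [div_lt_iff₀ hb] at hR
  linarith

lemma circleAverage_div_prod {ι : Type*} (S : Finset ι) (a b : ι → ℝ) (hb : ∀ i ∈ S, 0 < b i)
    (ha : ∀ i ∈ S, a i ≠ 0) (hinj : ∀ i ∈ S, ∀ j ∈ S, a i / b i = a j / b j → i = j)
    (f : ℂ → ℂ) (hf : Differentiable ℂ f) (hvan : ∀ i ∈ S, f ((-(a i / b i) : ℝ) : ℂ) = 0)
    {R : ℝ} (hR0 : 0 ≤ R) (hR : ∀ i ∈ S, |a i| / b i < R) :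
    Real.circleAverage (fun z => f z / ∏ i ∈ S, ((a i : ℂ) + z * b i)) 0 R =
      f 0 / ∏ i ∈ S, (a i : ℂ) := by
  obtain ⟨h, hh, hfh⟩ := exists_differentiable_factor S a b (fun i hi => (hb i hi).ne') hinj f hf
    hvan
  have h1 : Real.circleAverage (fun z => f z / ∏ i ∈ S, ((a i : ℂ) + z * b i)) 0 R =
      Real.circleAverage h 0 R := by
    refine Real.circleAverage_congr_sphere fun z hz => ?_
    have hz' : ‖z‖ = R := by simpa [abs_of_nonneg hR0] using hz
    change f z / _ = h z
    rw [hfh, mul_div_cancel_left₀]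
    exact prod_ne_zero_iff.2 fun i hi => add_circle_mul_ne_zero (hb i hi) (hR i hi) hz'
  rw [h1, DiffContOnCl.circleAverage hh.diffContOnCl, hfh 0, eq_comm]
  simp only [zero_mul, add_zero]
  exact mul_div_cancel_left₀ _ (prod_ne_zero_iff.2 fun i hi => by exact_mod_cast ha i hi)

variable {d : ℕ} {Sig Sp : Finset (E d)} {v : E d}

lemma alternating_sum_right_eq_zero [Fintype (weylGroup Sig)] {M : Type*} [AddCommGroup M]
    [Module ℝ M] {α : E d} (h0 : α ≠ 0) {s : weylGroup Sig} (hs : s.1 = rootReflection α)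
    (f : (E d ≃ₗᵢ[ℝ] E d) → M) (hf : ∀ w, f (w * rootReflection α) = f w) :
    ∑ w : weylGroup Sig, dsign w.1 • f w.1 = 0 := by
  have h : ∑ w : weylGroup Sig, dsign w.1 • f w.1 =
      ∑ w : weylGroup Sig, -(dsign w.1 • f w.1) := by
    rw [← Equiv.sum_comp (Equiv.mulRight s)]
    refine sum_congr rfl fun w _ => ?_
    rw [Equiv.coe_mulRight, Subgroup.coe_mul, hs, hf, dsign_mul, dsign_rootReflection h0,
      mul_neg_one, neg_smul]
  rw [sum_neg_distrib] at h
  have h2 : (2 : ℝ) • ∑ w : weylGroup Sig, dsign w.1 • f w.1 = 0 := by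
    rw [two_smul]
    nth_rewrite 1 [h]
    exact neg_add_cancel _
  exact (smul_eq_zero_iff_right two_ne_zero).1 h2

/-- The alternating exponential sum along complexified lines in direction `v`. -/
def altExp (Sig : Finset (E d)) [Fintype (weylGroup Sig)] (v : E d) (l : ℝ) (x y : E d)
    (z ζ : ℂ) : ℂ :=
  ∑ w : weylGroup Sig, (dsign w.1 : ℂ) * Complex.exp (l * (((⟪x, w.1 y⟫ : ℝ) : ℂ) +
    z * ((⟪v, w.1 y⟫ : ℝ) : ℂ) + ζ * ((⟪x, w.1 v⟫ : ℝ) : ℂ) + z * ζ * ((⟪v, w.1 v⟫ : ℝ) : ℂ)))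

/-- A radius exceeding all parameters at which `x + z v` meets a root hyperplane. -/
def lineRadius (Sp : Finset (E d)) (v x : E d) : ℝ := 1 + ∑ α ∈ Sp, |⟪α, x⟫| / ⟪α, v⟫

/-- The complexification of `piP` along the line through `x` in direction `v`. -/
def linePi (Sp : Finset (E d)) (v x : E d) (z : ℂ) : ℂ :=
  ∏ α ∈ Sp, (((⟪α, x⟫ : ℝ) : ℂ) + z * ((⟪α, v⟫ : ℝ) : ℂ))

lemma continuous_lineRadius : Continuous (lineRadius Sp v) := by
  unfold lineRadius
  fun_prop

lemma PositiveFor.div_lt_lineRadius (hv : PositiveFor Sig Sp v) (x : E d) {α : E d}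
    (hα : α ∈ Sp) : |⟪α, x⟫| / ⟪α, v⟫ < lineRadius Sp v x := by
  have h := single_le_sum (f := fun α => |⟪α, x⟫| / ⟪α, v⟫)
    (fun α hα => div_nonneg (abs_nonneg _) ((hv.2 α).1 hα).2.le) hα
  unfold lineRadius
  linarith

lemma PositiveFor.lineRadius_nonneg (hv : PositiveFor Sig Sp v) (x : E d) :
    0 ≤ lineRadius Sp v x :=
  add_nonneg zero_le_one <| sum_nonneg fun α hα =>
    div_nonneg (abs_nonneg _) ((hv.2 α).1 hα).2.le

lemma PositiveFor.linePi_ne_zero (hv : PositiveFor Sig Sp v) (x : E d) (θ : ℝ) :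
    linePi Sp v x (circleMap 0 (lineRadius Sp v x) θ) ≠ 0 :=
  prod_ne_zero_iff.2 fun α hα => add_circle_mul_ne_zero ((hv.2 α).1 hα).2
    (hv.div_lt_lineRadius x hα) (by
      rw [norm_circleMap_zero, abs_of_nonneg (hv.lineRadius_nonneg x)])

/-- The quotient of the alternating exponential sum by `piP x * piP y`, as a double mean value. -/
def altQuot (Sig Sp : Finset (E d)) [Fintype (weylGroup Sig)] (v : E d) (l : ℝ)
    (p : E d × E d) : ℂ :=
  Real.circleAverage (fun z => Real.circleAverage (fun ζ =>
    altExp Sig v l p.1 p.2 z ζ / linePi Sp v p.2 ζ / linePi Sp v p.1 z) 0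
      (lineRadius Sp v p.2)) 0 (lineRadius Sp v p.1)

lemma PositiveFor.continuous_altQuot [Fintype (weylGroup Sig)] (hv : PositiveFor Sig Sp v)
    (l : ℝ) : Continuous (altQuot Sig Sp v l) := by
  unfold altQuot Real.circleAverage
  refine Continuous.const_smul ?_ _
  refine intervalIntegral.continuous_parametric_intervalIntegral_of_continuous' ?_ _ _
  simp only [Function.uncurry_def]
  refine Continuous.const_smul ?_ _
  refine intervalIntegral.continuous_parametric_intervalIntegral_of_continuous' ?_ _ _
  simp only [Function.uncurry_def]
  have hR := continuous_lineRadius (Sp := Sp) (v := v)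
  have hz : Continuous fun q : ((E d × E d) × ℝ) × ℝ =>
      circleMap 0 (lineRadius Sp v q.1.1.1) q.1.2 := by
    unfold circleMap
    fun_prop
  have hζ : Continuous fun q : ((E d × E d) × ℝ) × ℝ =>
      circleMap 0 (lineRadius Sp v q.1.1.2) q.2 := by
    unfold circleMap
    fun_prop
  refine Continuous.div (Continuous.div ?_ ?_ fun q => hv.linePi_ne_zero _ _) ?_
    fun q => hv.linePi_ne_zero _ _
  · unfold altExp
    fun_prop
  · unfold linePi
    fun_prop
  · unfold linePi
    fun_prop

lemma altExp_eq_zero_left [Fintype (weylGroup Sig)] (hv : PositiveFor Sig Sp v) (l : ℝ)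
    (x y : E d) {α : E d} (hα : α ∈ Sp) :
    altExp Sig v l x y ((-(⟪α, x⟫ / ⟪α, v⟫) : ℝ) : ℂ) 0 = 0 := by
  obtain ⟨hSig, hα0⟩ := (hv.2 α).1 hα
  have hz : ⟪α, x + (-(⟪α, x⟫ / ⟪α, v⟫)) • v⟫ = 0 := by
    rw [inner_add_right, inner_smul_right]
    field_simp
    ring
  set z := -(⟪α, x⟫ / ⟪α, v⟫)
  refine Eq.trans ?_ (alternating_sum_eq_zero (M := ℂ) (H := univ) (hv.ne_zero hα)
    (s := ⟨rootReflection α, rootReflection_mem_weylGroup hSig⟩) rfl (fun _ _ => mem_univ _)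
    (fun w => ((Real.exp (l * ⟪x + z • v, w y⟫) : ℝ) : ℂ)) fun w => ?_)
  · refine sum_congr rfl fun w _ => ?_
    rw [inner_add_left, real_inner_smul_left, Complex.real_smul]
    push_cast
    congr 3
    ring
  · rw [LinearIsometryEquiv.coe_mul, Function.comp_apply, ← inner_rootReflection_left,
      rootReflection_eq_self hz]

lemma altExp_eq_zero_right [Fintype (weylGroup Sig)] (hv : PositiveFor Sig Sp v) (l : ℝ)
    (x y : E d) (z : ℂ) {α : E d} (hα : α ∈ Sp) :
    altExp Sig v l x y z ((-(⟪α, y⟫ / ⟪α, v⟫) : ℝ) : ℂ) = 0 := by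
  obtain ⟨hSig, hα0⟩ := (hv.2 α).1 hα
  have hz : ⟪α, y + (-(⟪α, y⟫ / ⟪α, v⟫)) • v⟫ = 0 := by
    rw [inner_add_right, inner_smul_right]
    field_simp
    ring
  set ζ := -(⟪α, y⟫ / ⟪α, v⟫)
  rw [← alternating_sum_right_eq_zero (M := ℂ) (hv.ne_zero hα)
    (s := ⟨rootReflection α, rootReflection_mem_weylGroup hSig⟩) rfl
    (fun w => Complex.exp (l * (((⟪x, w (y + ζ • v)⟫ : ℝ) : ℂ) +
      z * ((⟪v, w (y + ζ • v)⟫ : ℝ) : ℂ)))) fun w => ?_]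
  · refine sum_congr rfl fun w _ => ?_
    rw [map_add, map_smul, inner_add_right, inner_add_right, inner_smul_right, inner_smul_right,
      Complex.real_smul]
    push_cast
    congr 3
    ring
  · rw [LinearIsometryEquiv.coe_mul, Function.comp_apply, rootReflection_eq_self hz]

lemma PositiveFor.altQuot_eq [Fintype (weylGroup Sig)] (hv : PositiveFor Sig Sp v) (l : ℝ)
    {x y : E d} (hx : x ∈ genericSet Sp v) (hy : y ∈ genericSet Sp v) :
    altQuot Sig Sp v l (x, y) = altExp Sig v l x y 0 0 / piP Sp y / piP Sp x := by
  have hpos : ∀ α ∈ Sp, 0 < ⟪α, v⟫ := fun α hα => ((hv.2 α).1 hα).2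
  have hinner : ∀ z, Real.circleAverage (fun ζ => altExp Sig v l x y z ζ / linePi Sp v y ζ /
      linePi Sp v x z) 0 (lineRadius Sp v y) =
      altExp Sig v l x y z 0 / linePi Sp v x z / piP Sp y := by
    intro z
    have h1 := circleAverage_div_prod Sp (fun α => ⟪α, y⟫) (fun α => ⟪α, v⟫) hpos hy.1 hy.2
      (fun ζ => altExp Sig v l x y z ζ / linePi Sp v x z)
      (by unfold altExp; fun_prop)
      (fun α hα => by rw [altExp_eq_zero_right hv l x y z hα, zero_div])
      (hv.lineRadius_nonneg y) (fun α hα => hv.div_lt_lineRadius y hα)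
    rw [piP]
    push_cast
    rw [← h1]
    congr 1
    funext ζ
    rw [div_right_comm]
    rfl
  unfold altQuot
  simp only [hinner]
  have h1 := circleAverage_div_prod Sp (fun α => ⟪α, x⟫) (fun α => ⟪α, v⟫) hpos hx.1 hx.2
      (fun z => altExp Sig v l x y z 0 / piP Sp y)
      (by unfold altExp; fun_prop)
      (fun α hα => by rw [altExp_eq_zero_left hv l x y hα, zero_div])
      (hv.lineRadius_nonneg x) (fun α hα => hv.div_lt_lineRadius x hα)
  have h2 : ((piP Sp x : ℝ) : ℂ) = ∏ α ∈ Sp, ((⟪α, x⟫ : ℝ) : ℂ) := by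
    rw [piP]; push_cast; rfl
  rw [h2, ← h1]
  congr 1
  funext z
  rw [div_right_comm]
  rfl

lemma altExp_zero_zero [Fintype (weylGroup Sig)] (l : ℝ) (x y : E d) :
    altExp Sig v l x y 0 0 =
      ((∑ w : weylGroup Sig, dsign w.1 * Real.exp (l * ⟪x, w.1 y⟫) : ℝ) : ℂ) := by
  unfold altExp
  push_cast
  simp

/-- The alternating exponential sum is divisible by `piP x * piP y` with continuous quotient. -/
lemma PositiveFor.exists_continuous_quotient [Fintype (weylGroup Sig)]
    (hv : PositiveFor Sig Sp v) (hroot : IsRootSystem Sig) (l : ℝ) :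
    ∃ g : E d × E d → ℝ, Continuous g ∧ ∀ x y,
      ∑ w : weylGroup Sig, dsign w.1 * Real.exp (l * ⟪x, w.1 y⟫) =
        piP Sp x * piP Sp y * g (x, y) := by
  refine ⟨fun p => (altQuot Sig Sp v l p).re,
    Complex.continuous_re.comp (hv.continuous_altQuot l), fun x y => ?_⟩
  have hdense : Dense (genericSet Sp v ×ˢ genericSet Sp v) :=
    (hv.dense_genericSet hroot).prod (hv.dense_genericSet hroot)
  have hg : Continuous fun p => (altQuot Sig Sp v l p).re :=
    Complex.continuous_re.comp (hv.continuous_altQuot l)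
  have hpi := continuous_piP Sp
  refine congrFun (Continuous.ext_on hdense
    (f := fun p : E d × E d => ∑ w : weylGroup Sig, dsign w.1 * Real.exp (l * ⟪p.1, w.1 p.2⟫))
    (g := fun p => piP Sp p.1 * piP Sp p.2 * (altQuot Sig Sp v l p).re)
    (by fun_prop) (by fun_prop) ?_) (x, y)
  rintro ⟨x, y⟩ ⟨hx, hy⟩
  simp only
  rw [hv.altQuot_eq l hx hy, altExp_zero_zero, ← Complex.ofReal_div, ← Complex.ofReal_div,
    Complex.ofReal_re]
  have hx0 : piP Sp x ≠ 0 := prod_ne_zero_iff.2 hx.1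
  have hy0 : piP Sp y ≠ 0 := prod_ne_zero_iff.2 hy.1
  field_simp

end CircleQuotient

section SingularValues
variable {d : ℕ} {Sig Sp : Finset (E d)} {v : E d}

lemma piP_sdiff_mul {S T : Finset (E d)} (h : T ⊆ S) (z : E d) :
    piP (S \ T) z * piP T z = piP S z :=
  prod_sdiff h

lemma piP_add_smul_of_orthogonal {T : Finset (E d)} {q : E d} (h : ∀ α ∈ T, ⟪α, q⟫ = 0) (u : E d)
    (ε : ℝ) : piP T (q + ε • u) = ε ^ #T * piP T u := by
  unfold piP
  rw [← prod_const, ← prod_mul_distrib]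
  exact prod_congr rfl fun α hα => by rw [inner_add_right, h α hα, inner_smul_right, zero_add]

lemma stabLike_stabilizer [Fintype (weylGroup Sig)] (q : E d) :
    StabLike Sig Sp (univ.filter fun w : weylGroup Sig => w.1 q = q) q where
  fixed w hw := (mem_filter.1 hw).2
  reflection_mul_mem α _ hα s hs w hw := by
    refine mem_filter.2 ⟨mem_univ _, ?_⟩
    rw [Subgroup.coe_mul, LinearIsometryEquiv.coe_mul, Function.comp_apply, (mem_filter.1 hw).2,
      hs, rootReflection_eq_self hα]

lemma tendsto_piP_line_div {S : Finset (E d)} {q u : E d}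
    (hS : S = Sp.filter fun α => ⟪α, q⟫ = 0) {h : E d → ℝ} (hh : Continuous h) :
    Filter.Tendsto (fun ε : ℝ => piP Sp (q + ε • u) * h (q + ε • u) / ε ^ #S)
      (nhdsWithin 0 {0}ᶜ) (nhds (piP S u * piP (Sp \ S) q * h q)) := by
  have hc : Continuous fun ε : ℝ =>
      piP S u * piP (Sp \ S) (q + ε • u) * h (q + ε • u) := by
    have := continuous_piP (Sp \ S)
    fun_prop
  have h1 := (hc.tendsto 0).mono_left (nhdsWithin_le_nhds (s := {0}ᶜ))
  simp only [zero_smul, add_zero] at h1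
  refine h1.congr' ?_
  filter_upwards [self_mem_nhdsWithin] with ε hε
  have hε' : ε ≠ 0 := hε
  rw [← piP_sdiff_mul (hS ▸ filter_subset _ _ : S ⊆ Sp),
    piP_add_smul_of_orthogonal (T := S) (fun α hα => by rw [hS] at hα; exact (mem_filter.1 hα).2)]
  field_simp

variable [Fintype (weylGroup Sig)]

/-- Averaging an alternating sum over the right cosets of the stabilizer of `Y`. -/
lemma PositiveFor.cConst_mul_alternating_sum (hv : PositiveFor Sig Sp v)
    (hroot : IsRootSystem Sig) {Y : E d} {S : Finset (E d)}
    (hS : S = Sp.filter fun α => ⟪α, Y⟫ = 0) (φ : ℝ → ℝ) (x : E d) :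
    cConst S * ∑ w : weylGroup Sig, dsign w.1 * φ ⟪x, w.1 Y⟫ * ⟪x, w.1 v⟫ ^ #S =
      (#S).factorial * piP S v * ∑ w : weylGroup Sig,
        dsign w.1 * φ ⟪x, w.1 Y⟫ * piP S (w.1⁻¹ x) := by
  set H := univ.filter fun w : weylGroup Sig => w.1 Y = Y
  have hH : StabLike Sig Sp H Y := stabLike_stabilizer Y
  have hpow := fun z => hv.cConst_mul_sum_pow hroot hH hS z v
  have hHpos : (#H : ℝ) ≠ 0 := by
    have : (1 : weylGroup Sig) ∈ H := mem_filter.2 ⟨mem_univ _, rfl⟩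
    exact_mod_cast (card_pos.2 ⟨_, this⟩).ne'
  have havg : (#H : ℝ) * ∑ w : weylGroup Sig, dsign w.1 * φ ⟪x, w.1 Y⟫ *
      ⟪x, w.1 v⟫ ^ #S = ∑ w : weylGroup Sig, dsign w.1 * φ ⟪x, w.1 Y⟫ *
        ∑ s ∈ H, dsign s.1 * ⟪w.1⁻¹ x, s.1 v⟫ ^ #S := by
    simp only [mul_sum]
    rw [sum_comm (s := univ) (t := H), ← mul_sum, ← nsmul_eq_mul, ← sum_const]
    refine sum_congr rfl fun s hs => ?_
    rw [← Equiv.sum_comp (Equiv.mulRight s)]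
    refine sum_congr rfl fun w _ => ?_
    rw [Equiv.coe_mulRight, Subgroup.coe_mul, dsign_mul, LinearIsometryEquiv.coe_mul,
      Function.comp_apply, Function.comp_apply, hH.fixed s hs, inner_inv_apply_left]
    ring
  refine mul_left_cancel₀ hHpos ?_
  rw [mul_left_comm, havg, mul_sum, mul_sum, mul_sum]
  refine sum_congr rfl fun w _ => ?_
  linear_combination (dsign w.1 * φ ⟪x, w.1 Y⟫) * hpow (w.1⁻¹ x)

lemma PositiveFor.quotient_singular_right (hv : PositiveFor Sig Sp v) (hroot : IsRootSystem Sig)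
    {g : E d × E d → ℝ} (hgc : Continuous g) {l : ℝ}
    (hg : ∀ x y, ∑ w : weylGroup Sig, dsign w.1 * Real.exp (l * ⟪x, w.1 y⟫) =
        piP Sp x * piP Sp y * g (x, y)) {Y : E d} {S : Finset (E d)}
    (hS : S = Sp.filter fun α => ⟪α, Y⟫ = 0) (x : E d) :
    piP Sp x * (cConst S * piP (Sp \ S) Y * g (x, Y)) = l ^ #S *
      ∑ w : weylGroup Sig, dsign w.1 * Real.exp (l * ⟪x, w.1 Y⟫) * piP S (w.1⁻¹ x) := by
  have h1 := tendsto_piP_line_div (u := v) hS (h := fun y => piP Sp x * g (x, y)) (by fun_prop)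
  have h2 := eq_sum_coeff_of_tendsto_div_pow (univ : Finset (weylGroup Sig))
    (fun w => Polynomial.C (dsign w.1 * Real.exp (l * ⟪x, w.1 Y⟫))) (fun w => l * ⟪x, w.1 v⟫) #S
    (h1.congr fun ε => by
      congr 1
      rw [mul_left_comm, ← mul_assoc, ← hg]
      refine sum_congr rfl fun w _ => ?_
      rw [Polynomial.eval_C, mul_assoc, ← Real.exp_add, map_add, map_smul, inner_add_right,
        inner_smul_right]
      congr 2
      ring)
  have h3 : ∀ w : weylGroup Sig, ∑ j ∈ range (#S + 1),
      (Polynomial.C (dsign w.1 * Real.exp (l * ⟪x, w.1 Y⟫))).coeff j *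
        ((l * ⟪x, w.1 v⟫) ^ (#S - j) / (#S - j).factorial) =
      dsign w.1 * Real.exp (l * ⟪x, w.1 Y⟫) * ((l * ⟪x, w.1 v⟫) ^ #S / (#S).factorial) := by
    intro w
    rw [sum_range_succ', sum_eq_zero, zero_add, Polynomial.coeff_C_zero, Nat.sub_zero]
    exact fun j _ => by rw [Polynomial.coeff_C_succ, zero_mul]
  simp only [h3] at h2
  have h4 := hv.cConst_mul_alternating_sum hroot hS (fun t => Real.exp (l * t)) x
  have hfac : ((#S).factorial : ℝ) ≠ 0 := by exact_mod_cast Nat.factorial_ne_zero _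
  have hpiv := (hv.piP_pos (hS ▸ filter_subset _ _ : S ⊆ Sp)).ne'
  have h5 : (#S).factorial * (piP S v * piP (Sp \ S) Y * (piP Sp x * g (x, Y))) = l ^ #S *
      ∑ w : weylGroup Sig, dsign w.1 * Real.exp (l * ⟪x, w.1 Y⟫) * ⟪x, w.1 v⟫ ^ #S := by
    rw [h2, mul_sum, mul_sum]
    refine sum_congr rfl fun w _ => ?_
    rw [mul_pow, mul_div_assoc', mul_div_assoc', mul_div_cancel_left₀ _ hfac]
    ring
  refine mul_left_cancel₀ (mul_ne_zero hfac hpiv) ?_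
  linear_combination cConst S * h5 + l ^ #S * h4

/-- The polynomial `ε ↦ piP S (X + ε v)`. -/
def linePoly (S : Finset (E d)) (X v : E d) : Polynomial ℝ :=
  ∏ α ∈ S, (Polynomial.C ⟪α, v⟫ * Polynomial.X + Polynomial.C ⟪α, X⟫)

lemma eval_linePoly (S : Finset (E d)) (X v : E d) (ε : ℝ) :
    (linePoly S X v).eval ε = piP S (X + ε • v) := by
  rw [linePoly, piP, Polynomial.eval_prod]
  refine prod_congr rfl fun α _ => ?_
  rw [inner_add_right, inner_smul_right]
  simp only [Polynomial.eval_add, Polynomial.eval_mul, Polynomial.eval_C, Polynomial.eval_X]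
  ring

lemma PositiveFor.quotient_singular_both (hv : PositiveFor Sig Sp v) (hroot : IsRootSystem Sig)
    {g : E d × E d → ℝ} (hgc : Continuous g) {l : ℝ}
    (hg : ∀ x y, ∑ w : weylGroup Sig, dsign w.1 * Real.exp (l * ⟪x, w.1 y⟫) =
        piP Sp x * piP Sp y * g (x, y)) {X Y : E d} {S T : Finset (E d)}
    (hS : S = Sp.filter fun α => ⟪α, X⟫ = 0) (hT : T = Sp.filter fun α => ⟪α, Y⟫ = 0) :
    piP S v * piP (Sp \ S) X * (cConst T * piP (Sp \ T) Y * g (X, Y)) =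
      ∑ w : weylGroup Sig, ∑ i ∈ range (#S + 1), l ^ #T * (dsign w.1 *
        Real.exp (l * ⟪X, w.1 Y⟫) * (linePoly T (w.1⁻¹ X) (w.1⁻¹ v)).coeff i *
          ((l * ⟪v, w.1 Y⟫) ^ (#S - i) / (#S - i).factorial)) := by
  have h1 := tendsto_piP_line_div (u := v) hS
    (h := fun x => cConst T * piP (Sp \ T) Y * g (x, Y)) (by fun_prop)
  rw [eq_sum_coeff_of_tendsto_div_pow (univ : Finset (weylGroup Sig))
    (fun w => Polynomial.C (l ^ #T * (dsign w.1 * Real.exp (l * ⟪X, w.1 Y⟫))) *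
      linePoly T (w.1⁻¹ X) (w.1⁻¹ v)) (fun w => l * ⟪v, w.1 Y⟫) #S
    (h1.congr fun ε => by
      congr 1
      rw [hv.quotient_singular_right hroot hgc hg hT, mul_sum]
      refine sum_congr rfl fun w _ => ?_
      rw [Polynomial.eval_mul, Polynomial.eval_C, eval_linePoly, inner_add_left,
        real_inner_smul_left, mul_add, Real.exp_add, map_add, map_smul, mul_left_comm l ε,
        mul_comm ε]
      ring)]
  refine sum_congr rfl fun w _ => sum_congr rfl fun i _ => ?_
  rw [Polynomial.coeff_C_mul]
  ring

end SingularValues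

section StabilizerSums

lemma coeff_linear_pow (a b : ℝ) (n j : ℕ) (hj : j ≤ n) :
    ((Polynomial.C b * Polynomial.X + Polynomial.C a) ^ n).coeff j =
      n.choose j * (a ^ (n - j) * b ^ j) := by
  rw [add_pow, Polynomial.finsetSum_coeff, sum_eq_single j]
  · rw [mul_pow, ← Polynomial.C_pow, ← Polynomial.C_pow, ← Polynomial.C_eq_natCast,
      Polynomial.coeff_mul_C, Polynomial.coeff_mul_C, Polynomial.coeff_C_mul_X_pow, if_pos rfl]
    ring
  · intro m _ hm
    rw [mul_pow, ← Polynomial.C_pow, ← Polynomial.C_pow, ← Polynomial.C_eq_natCast,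
      Polynomial.coeff_mul_C, Polynomial.coeff_mul_C, Polynomial.coeff_C_mul_X_pow,
      if_neg hm.symm, zero_mul, zero_mul]
  · intro h
    exact absurd (mem_range.2 (by omega)) h

lemma card_mul_sum_mul_set {G : Type*} [Group G] {A B K O : Finset G}
    (hA : ∀ a ∈ A, ∀ s ∈ K, a * s ∈ A) (hB : ∀ s ∈ K, ∀ b ∈ B, s⁻¹ * b ∈ B)
    (hK : ∀ a ∈ A, ∀ a' ∈ A, ∀ b ∈ B, ∀ b' ∈ B, a * b = a' * b' → a⁻¹ * a' ∈ K)
    (hO : ∀ w, w ∈ O ↔ ∃ a ∈ A, ∃ b ∈ B, w = a * b) {φ ψ : G → ℝ}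
    (hφ : ∀ a ∈ A, ∀ b ∈ B, φ (a * b) = ψ a) :
    #K * ∑ w ∈ O, φ w = #B * ∑ a ∈ A, ψ a := by
  have h1 : (#B : ℝ) * ∑ a ∈ A, ψ a = ∑ p ∈ A ×ˢ B, φ (p.1 * p.2) := by
    rw [sum_product, mul_sum]
    refine sum_congr rfl fun a ha => ?_
    rw [sum_congr rfl fun b hb => hφ a ha b hb, sum_const, nsmul_eq_mul]
  have hmaps : ∀ p ∈ A ×ˢ B, p.1 * p.2 ∈ O := fun p hp =>
    (hO _).2 ⟨p.1, (mem_product.1 hp).1, p.2, (mem_product.1 hp).2, rfl⟩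
  rw [h1, ← sum_fiberwise_of_maps_to hmaps, mul_sum]
  refine sum_congr rfl fun w hw => ?_
  obtain ⟨a, ha, b, hb, rfl⟩ := (hO w).1 hw
  rw [sum_congr rfl fun p hp => by rw [(mem_filter.1 hp).2], sum_const, nsmul_eq_mul]
  congr 2
  refine card_bij (fun s _ => (a * s, s⁻¹ * b)) ?_ ?_ ?_
  · intro s hs
    refine mem_filter.2 ⟨mem_product.2 ⟨hA a ha s hs, hB s hs b hb⟩, ?_⟩
    group
  · intro s _ s' _ h
    exact mul_left_cancel (congrArg Prod.fst h)
  · rintro ⟨a', b'⟩ hp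
    obtain ⟨hp1, hp2⟩ := mem_filter.1 hp
    obtain ⟨ha', hb'⟩ := mem_product.1 hp1
    simp only at ha' hb' hp2
    refine ⟨a⁻¹ * a', hK a ha a' ha' b hb b' hb' hp2.symm, ?_⟩
    ext1
    · group
    · simp only [mul_inv_rev, inv_inv]
      rw [mul_assoc, ← hp2]
      group

variable {d : ℕ} {Sig Sp : Finset (E d)} {v : E d}

lemma linePoly_eq_of_orthogonal {S T : Finset (E d)} (hT : T ⊆ S) {q : E d}
    (h : ∀ α ∈ T, ⟪α, q⟫ = 0) (u : E d) :
    linePoly S q u = Polynomial.C (piP T u) * linePoly (S \ T) q u * Polynomial.X ^ #T := by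
  refine Polynomial.funext fun ε => ?_
  rw [Polynomial.eval_mul, Polynomial.eval_mul, Polynomial.eval_C, Polynomial.eval_pow,
    Polynomial.eval_X, eval_linePoly, eval_linePoly, ← piP_sdiff_mul hT,
    piP_add_smul_of_orthogonal h]
  ring

lemma coeff_linePoly_of_lt {S T : Finset (E d)} (hT : T ⊆ S) {q : E d}
    (h : ∀ α ∈ T, ⟪α, q⟫ = 0) (u : E d) {i : ℕ} (hi : i < #T) : (linePoly S q u).coeff i = 0 := by
  rw [linePoly_eq_of_orthogonal hT h, Polynomial.coeff_mul_X_pow', if_neg (by omega)]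

lemma coeff_linePoly_card {S T : Finset (E d)} (hT : T ⊆ S) {q : E d}
    (h : ∀ α ∈ T, ⟪α, q⟫ = 0) (u : E d) :
    (linePoly S q u).coeff #T = piP T u * piP (S \ T) q := by
  rw [linePoly_eq_of_orthogonal hT h, Polynomial.coeff_mul_X_pow', if_pos le_rfl, Nat.sub_self,
    Polynomial.coeff_C_mul, Polynomial.coeff_zero_eq_eval_zero, eval_linePoly, zero_smul, add_zero]

/-- Polarization of `cConst_mul_sum_pow` at a singular second argument. -/
lemma PositiveFor.cConst_mul_sum_mixed_pow (hv : PositiveFor Sig Sp v)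
    (hroot : IsRootSystem Sig) {q Y : E d} {S T : Finset (E d)} {H : Finset (weylGroup Sig)}
    (hH : StabLike Sig Sp H q) (hS : S = Sp.filter fun α => ⟪α, q⟫ = 0) (hTS : T ⊆ S)
    (hT : ∀ α ∈ T, ⟪α, Y⟫ = 0) (z y : E d) :
    cConst S * ((#S).choose #T * ∑ w ∈ H, dsign w.1 *
      (⟪z, w.1 Y⟫ ^ (#S - #T) * ⟪z, w.1 y⟫ ^ #T)) =
      (#S).factorial * #H * piP S z * (piP T y * piP (S \ T) Y) := by
  have h1 : Polynomial.C (cConst S) * ∑ w ∈ H, Polynomial.C (dsign w.1) *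
      (Polynomial.C ⟪z, w.1 y⟫ * Polynomial.X + Polynomial.C ⟪z, w.1 Y⟫) ^ #S =
      Polynomial.C ((#S).factorial * #H * piP S z) * linePoly S Y y := by
    refine Polynomial.funext fun ε => ?_
    have := hv.cConst_mul_sum_pow hroot hH hS z (Y + ε • y)
    rw [Polynomial.eval_mul, Polynomial.eval_mul, Polynomial.eval_C, Polynomial.eval_C,
      eval_linePoly, ← this, Polynomial.eval_finsetSum]
    congr 1
    refine sum_congr rfl fun w _ => ?_
    simp only [Polynomial.eval_mul, Polynomial.eval_C, Polynomial.eval_pow, Polynomial.eval_add,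
      Polynomial.eval_X, map_add, map_smul, inner_add_right, inner_smul_right]
    ring
  have h2 := congrArg (fun p => Polynomial.coeff p #T) h1
  simp only [Polynomial.coeff_C_mul, Polynomial.finsetSum_coeff] at h2
  rw [coeff_linePoly_card hTS hT] at h2
  rw [← h2, mul_sum]
  congr 1
  refine sum_congr rfl fun w _ => ?_
  rw [coeff_linear_pow _ _ _ _ (card_le_card hTS)]
  ring

variable [Fintype (weylGroup Sig)]

lemma PositiveFor.cConst_mul_sum_stabilizer (hv : PositiveFor Sig Sp v)
    (hroot : IsRootSystem Sig) {X Y : E d} {S T : Finset (E d)} {H K : Finset (weylGroup Sig)}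
    (hS : S = Sp.filter fun α => ⟪α, X⟫ = 0) (hTS : T ⊆ S) (hTY : ∀ α ∈ T, ⟪α, Y⟫ = 0)
    (hT : T = Sp.filter fun α => ⟪α, X + Y⟫ = 0)
    (hH : H = univ.filter fun w : weylGroup Sig => w.1 X = X)
    (hK : K = univ.filter fun w : weylGroup Sig => w.1 X = X ∧ w.1 Y = Y) :
    cConst S * ∑ w ∈ H, dsign w.1 * ⟪v, w.1 Y⟫ ^ (#S - #T) * piP T (w.1⁻¹ v) =
      (#S - #T).factorial * #H * cConst T * piP S v * piP (S \ T) Y := by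
  have hH' : StabLike Sig Sp H X := hH ▸ stabLike_stabilizer X
  have hKY : ∀ w ∈ K, w.1 Y = Y := fun w hw => by rw [hK] at hw; exact (mem_filter.1 hw).2.2
  have hKX : ∀ w ∈ K, w.1 X = X := fun w hw => by rw [hK] at hw; exact (mem_filter.1 hw).2.1
  have hK' : StabLike Sig Sp K (X + Y) := by
    refine ⟨fun w hw => by rw [map_add, hKX w hw, hKY w hw], fun α hα hαq s hs w hw => ?_⟩
    have hαT : α ∈ T := by rw [hT]; exact mem_filter.2 ⟨hα, hαq⟩
    have hαX : ⟪α, X⟫ = 0 := by have := hTS hαT; rw [hS] at this; exact (mem_filter.1 this).2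
    rw [hK]
    refine mem_filter.2 ⟨mem_univ _, ?_, ?_⟩
    · rw [Subgroup.coe_mul, LinearIsometryEquiv.coe_mul, Function.comp_apply, hKX w hw, hs,
        rootReflection_eq_self hαX]
    · rw [Subgroup.coe_mul, LinearIsometryEquiv.coe_mul, Function.comp_apply, hKY w hw, hs,
        rootReflection_eq_self (hTY α hαT)]
  have hKpos : (#K : ℝ) ≠ 0 := by
    have : (1 : weylGroup Sig) ∈ K := hK ▸ mem_filter.2 ⟨mem_univ _, rfl, rfl⟩
    exact_mod_cast (card_pos.2 ⟨_, this⟩).ne'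
  have hpiv := (hv.piP_pos (hTS.trans (hS ▸ filter_subset _ _ : S ⊆ Sp))).ne'
  have h1 := hv.cConst_mul_sum_mixed_pow hroot hH' hS hTS hTY v v
  have hpow := fun z => hv.cConst_mul_sum_pow hroot hK' hT z v
  have hchoose : ((#S).choose #T : ℝ) * (#T).factorial * (#S - #T).factorial =
      (#S).factorial := by
    exact_mod_cast Nat.choose_mul_factorial_mul_factorial (card_le_card hTS)
  have havg : (#K : ℝ) * ∑ w ∈ H, dsign w.1 * (⟪v, w.1 Y⟫ ^ (#S - #T) * ⟪v, w.1 v⟫ ^ #T) =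
      ∑ w ∈ H, dsign w.1 * ⟪v, w.1 Y⟫ ^ (#S - #T) *
        ∑ s ∈ K, dsign s.1 * ⟪w.1⁻¹ v, s.1 v⟫ ^ #T := by
    simp only [mul_sum (s := K)]
    rw [sum_comm (s := H) (t := K), ← nsmul_eq_mul, ← sum_const]
    refine sum_congr rfl fun s hs => ?_
    symm
    refine sum_equiv (Equiv.mulRight s) (fun w => ?_) fun w _ => ?_
    · rw [hH, mem_filter, mem_filter, Equiv.coe_mulRight, Subgroup.coe_mul,
        LinearIsometryEquiv.coe_mul, Function.comp_apply, hKX s hs]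
      simp only [mem_univ, true_and]
    · rw [Equiv.coe_mulRight, Subgroup.coe_mul, dsign_mul, LinearIsometryEquiv.coe_mul,
        Function.comp_apply, Function.comp_apply, hKY s hs, inner_inv_apply_left]
      ring
  have h2 : cConst T * ∑ w ∈ H, dsign w.1 * (⟪v, w.1 Y⟫ ^ (#S - #T) * ⟪v, w.1 v⟫ ^ #T) =
      (#T).factorial * piP T v *
        ∑ w ∈ H, dsign w.1 * ⟪v, w.1 Y⟫ ^ (#S - #T) * piP T (w.1⁻¹ v) := by
    refine mul_left_cancel₀ hKpos ?_
    rw [mul_left_comm, havg, mul_sum, mul_sum, mul_sum]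
    refine sum_congr rfl fun w _ => ?_
    linear_combination (dsign w.1 * ⟪v, w.1 Y⟫ ^ (#S - #T)) * hpow (w.1⁻¹ v)
  have hc : ((#S).choose #T : ℝ) * (#T).factorial * piP T v ≠ 0 := by
    refine mul_ne_zero (mul_ne_zero ?_ ?_) hpiv
    · exact_mod_cast (Nat.choose_pos (card_le_card hTS)).ne'
    · exact_mod_cast Nat.factorial_ne_zero _
  refine mul_left_cancel₀ hc ?_
  linear_combination cConst T * h1 - cConst S * ((#S).choose #T : ℝ) * h2 -
    #H * piP S v * piP (S \ T) Y * piP T v * cConst T * hchoose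

end StabilizerSums

section LargeParameter

lemma tendsto_exp_term_of_lt {A B : ℝ} (h : B < A) (m k n : ℕ) (a q b : ℝ) :
    Filter.Tendsto (fun l : ℝ => (l ^ m)⁻¹ * Real.exp (-(l * A)) *
      (l ^ k * (a * Real.exp (l * B) * q * ((l * b) ^ n / n.factorial)))) Filter.atTop
      (nhds 0) := by
  have h1 := (tendsto_rpow_mul_exp_neg_mul_atTop_nhds_zero ((k : ℝ) + n - m) (A - B)
    (sub_pos.2 h)).const_mul (a * q * (b ^ n / n.factorial))
  rw [mul_zero] at h1
  refine h1.congr' ?_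
  filter_upwards [Filter.eventually_gt_atTop 0] with l hl
  rw [Real.rpow_sub hl, Real.rpow_add hl, Real.rpow_natCast, Real.rpow_natCast, Real.rpow_natCast,
    show -(A - B) * l = -(l * A) + l * B by ring, Real.exp_add, mul_pow]
  field_simp

lemma tendsto_exp_term_of_eq {m k n : ℕ} (h : k + n = m) (A a q b : ℝ) :
    Filter.Tendsto (fun l : ℝ => (l ^ m)⁻¹ * Real.exp (-(l * A)) *
      (l ^ k * (a * Real.exp (l * A) * q * ((l * b) ^ n / n.factorial)))) Filter.atTop
      (nhds (a * q * (b ^ n / n.factorial))) := by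
  refine tendsto_const_nhds.congr' ?_
  filter_upwards [Filter.eventually_gt_atTop 0] with l hl
  rw [← h, Real.exp_neg, mul_pow, pow_add]
  field_simp

lemma tendsto_exp_term_of_degree_lt {m k n : ℕ} (h : k + n < m) (A a q b : ℝ) :
    Filter.Tendsto (fun l : ℝ => (l ^ m)⁻¹ * Real.exp (-(l * A)) *
      (l ^ k * (a * Real.exp (l * A) * q * ((l * b) ^ n / n.factorial)))) Filter.atTop
      (nhds 0) := by
  have h1 := (Filter.tendsto_pow_atTop (α := ℝ) (n := m - (k + n)) (by omega)).inv_tendsto_atTop.mul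
    (tendsto_exp_term_of_eq (rfl : k + n = k + n) A a q b)
  rw [zero_mul] at h1
  refine h1.congr fun l => ?_
  rw [Pi.inv_apply, ← Nat.sub_add_cancel h.le, pow_add, Nat.add_sub_cancel, mul_inv]
  ring

variable {d : ℕ} {Sig Sp : Finset (E d)} {v : E d}

lemma PositiveFor.linePoly_inv_mul (hv : PositiveFor Sig Sp v) (hroot : IsRootSystem Sig)
    {X Y : E d} {T : Finset (E d)} (hT : T = Sp.filter fun α => ⟪α, Y⟫ = 0)
    {w₁ w₂ : weylGroup Sig} (h₁ : w₁.1 X = X) (h₂ : w₂.1 Y = Y) :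
    linePoly T ((w₁ * w₂).1⁻¹ X) ((w₁ * w₂).1⁻¹ v) =
      Polynomial.C (dsign w₂.1) * linePoly T X (w₁.1⁻¹ v) := by
  have h₁' : w₁.1⁻¹ X = X := by
    rw [LinearIsometryEquiv.coe_inv, LinearIsometryEquiv.symm_apply_eq, h₁]
  have h₂' : w₂.1⁻¹ Y = Y := by
    rw [LinearIsometryEquiv.coe_inv, LinearIsometryEquiv.symm_apply_eq, h₂]
  have hs : dsign w₂.1⁻¹ = dsign w₂.1 := by
    have h1 := dsign_inv w₂.1
    have h2 := dsign_mul_self hroot.1 w₂.2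
    exact mul_right_cancel₀ (right_ne_zero_of_mul_eq_one h1) (h1.trans h2.symm)
  refine Polynomial.funext fun ε => ?_
  rw [Polynomial.eval_mul, Polynomial.eval_C, eval_linePoly, eval_linePoly, hT, ← hs,
    ← hv.piP_map_of_fixed hroot (inv_mem w₂.2) h₂', Subgroup.coe_mul, mul_inv_rev,
    LinearIsometryEquiv.coe_mul, Function.comp_apply, Function.comp_apply, h₁', map_add, map_smul]

variable [Fintype (weylGroup Sig)]

lemma PositiveFor.tendsto_const_mul_quotient (hv : PositiveFor Sig Sp v)
    (hroot : IsRootSystem Sig) {X Y : E d}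
    (hX : ∀ α ∈ Sp, 0 ≤ ⟪α, X⟫) (hY : ∀ α ∈ Sp, 0 ≤ ⟪α, Y⟫)
    (hKM : ∀ w : weylGroup Sig, ⟪X, w.1 Y⟫ = ⟪X, Y⟫ ↔
      ∃ w₁ w₂ : weylGroup Sig, w₁.1 X = X ∧ w₂.1 Y = Y ∧ w = w₁ * w₂)
    {S T : Finset (E d)}
    (hS : S = Sp.filter fun α => ⟪α, X⟫ = 0) (hT : T = Sp.filter fun α => ⟪α, Y⟫ = 0)
    {g : ℝ → E d × E d → ℝ} (hgc : ∀ l, Continuous (g l))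
    (hg : ∀ l x y, ∑ w : weylGroup Sig, dsign w.1 * Real.exp (l * ⟪x, w.1 y⟫) =
        piP Sp x * piP Sp y * g l (x, y)) :
    Filter.Tendsto (fun l : ℝ => piP S v * piP (Sp \ S) X * (cConst T * piP (Sp \ T) Y) *
        ((l ^ #(S ∪ T))⁻¹ * Real.exp (-(l * ⟪X, Y⟫)) * g l (X, Y))) Filter.atTop
      (nhds (∑ w ∈ univ.filter fun w : weylGroup Sig => ⟪X, w.1 Y⟫ = ⟪X, Y⟫, dsign w.1 *
        (linePoly T (w.1⁻¹ X) (w.1⁻¹ v)).coeff #(S ∩ T) *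
          (⟪v, w.1 Y⟫ ^ (#S - #(S ∩ T)) / (#S - #(S ∩ T)).factorial))) := by
  have hcard := card_union_add_card_inter S T
  have hjS : #(S ∩ T) ≤ #S := card_le_card inter_subset_left
  have horth : ∀ α ∈ S ∩ T, ⟪α, X⟫ = 0 := fun α hα => by
    have := (mem_inter.1 hα).1
    rw [hS] at this
    exact (mem_filter.1 this).2
  have hlim : ∀ w : weylGroup Sig, ∀ i ∈ range (#S + 1), Filter.Tendsto (fun l : ℝ =>
      (l ^ #(S ∪ T))⁻¹ * Real.exp (-(l * ⟪X, Y⟫)) * (l ^ #T * (dsign w.1 *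
        Real.exp (l * ⟪X, w.1 Y⟫) * (linePoly T (w.1⁻¹ X) (w.1⁻¹ v)).coeff i *
          ((l * ⟪v, w.1 Y⟫) ^ (#S - i) / (#S - i).factorial)))) Filter.atTop
      (nhds (if ⟪X, w.1 Y⟫ = ⟪X, Y⟫ then if #(S ∩ T) = i then dsign w.1 *
        (linePoly T (w.1⁻¹ X) (w.1⁻¹ v)).coeff i *
          (⟪v, w.1 Y⟫ ^ (#S - i) / (#S - i).factorial) else 0 else 0)) := by
    intro w i hi
    have hi' := mem_range.1 hi
    split_ifs with hw hj
    · rw [hw]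
      exact tendsto_exp_term_of_eq (by omega) _ _ _ _
    · rw [hw]
      rcases lt_or_gt_of_ne hj with hj | hj
      · exact tendsto_exp_term_of_degree_lt (by omega) _ _ _ _
      · obtain ⟨w₁, w₂, h₁, h₂, rfl⟩ := (hKM w).1 hw
        rw [hv.linePoly_inv_mul hroot hT h₁ h₂, Polynomial.coeff_C_mul,
          coeff_linePoly_of_lt inter_subset_right horth _ hj]
        simp
    · exact tendsto_exp_term_of_lt (lt_of_le_of_ne (hv.inner_apply_le hroot hX hY w) hw) _ _ _ _ _ _
  have h1 := tendsto_finsetSum univ fun w _ => tendsto_finsetSum (range (#S + 1)) (hlim w)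
  have h2 : ∀ w : weylGroup Sig, (∑ i ∈ range (#S + 1),
      (if ⟪X, w.1 Y⟫ = ⟪X, Y⟫ then if #(S ∩ T) = i then dsign w.1 *
        (linePoly T (w.1⁻¹ X) (w.1⁻¹ v)).coeff i *
          (⟪v, w.1 Y⟫ ^ (#S - i) / (#S - i).factorial) else 0 else 0)) =
      if ⟪X, w.1 Y⟫ = ⟪X, Y⟫ then dsign w.1 *
        (linePoly T (w.1⁻¹ X) (w.1⁻¹ v)).coeff #(S ∩ T) *
          (⟪v, w.1 Y⟫ ^ (#S - #(S ∩ T)) / (#S - #(S ∩ T)).factorial) else 0 := by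
    intro w
    split_ifs with hw
    · rw [sum_ite_eq, if_pos (mem_range.2 (by omega))]
    · exact sum_const_zero
  rw [sum_congr rfl fun w _ => h2 w, ← sum_filter] at h1
  refine h1.congr fun l => ?_
  have h3 := hv.quotient_singular_both hroot (hgc l) (hg l) hS hT
  simp only [← mul_sum] at h3 ⊢
  rw [← h3]
  ring

lemma PositiveFor.tendsto_quotient (hv : PositiveFor Sig Sp v)
    (hroot : IsRootSystem Sig) {X Y : E d}
    (hX : ∀ α ∈ Sp, 0 ≤ ⟪α, X⟫) (hY : ∀ α ∈ Sp, 0 ≤ ⟪α, Y⟫)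
    (hKM : ∀ w : weylGroup Sig, ⟪X, w.1 Y⟫ = ⟪X, Y⟫ ↔
      ∃ w₁ w₂ : weylGroup Sig, w₁.1 X = X ∧ w₂.1 Y = Y ∧ w = w₁ * w₂)
    {S T : Finset (E d)}
    (hS : S = Sp.filter fun α => ⟪α, X⟫ = 0) (hT : T = Sp.filter fun α => ⟪α, Y⟫ = 0)
    {A B K : Finset (weylGroup Sig)}
    (hA : A = univ.filter fun w : weylGroup Sig => w.1 X = X)
    (hB : B = univ.filter fun w : weylGroup Sig => w.1 Y = Y)
    (hK : K = univ.filter fun w : weylGroup Sig => w.1 X = X ∧ w.1 Y = Y)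
    {g : ℝ → E d × E d → ℝ} (hgc : ∀ l, Continuous (g l))
    (hg : ∀ l x y, ∑ w : weylGroup Sig, dsign w.1 * Real.exp (l * ⟪x, w.1 y⟫) =
        piP Sp x * piP Sp y * g l (x, y)) :
    Filter.Tendsto (fun l : ℝ => (l ^ #(S ∪ T))⁻¹ * Real.exp (-(l * ⟪X, Y⟫)) * g l (X, Y))
      Filter.atTop (nhds (cConst (S ∩ T) / (cConst S * cConst T) * (#A * #B / #K : ℝ) *
        (piP (Sp \ (S ∪ T)) X * piP (Sp \ (S ∪ T)) Y)⁻¹)) := by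
  have hmA : ∀ w, w ∈ A ↔ w.1 X = X := fun w => by simp [hA]
  have hmB : ∀ w, w ∈ B ↔ w.1 Y = Y := fun w => by simp [hB]
  have hmK : ∀ w, w ∈ K ↔ w.1 X = X ∧ w.1 Y = Y := fun w => by simp [hK]
  have hSsub : S ⊆ Sp := hS ▸ filter_subset _ _
  have hTsub : T ⊆ Sp := hT ▸ filter_subset _ _
  have hSX : ∀ α ∈ S, ⟪α, X⟫ = 0 := fun α hα => by
    rw [hS] at hα
    exact (mem_filter.1 hα).2
  have hTY : ∀ α ∈ T, ⟪α, Y⟫ = 0 := fun α hα => by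
    rw [hT] at hα
    exact (mem_filter.1 hα).2
  have hST : S ∩ T = Sp.filter fun α => ⟪α, X + Y⟫ = 0 := by
    ext α
    simp only [hS, hT, mem_inter, mem_filter, inner_add_right]
    refine ⟨fun h => ⟨h.1.1, by rw [h.1.2, h.2.2, add_zero]⟩, fun h => ?_⟩
    have h1 := hX α h.1
    have h2 := hY α h.1
    exact ⟨⟨h.1, by linarith [h.2]⟩, h.1, by linarith [h.2]⟩
  have hprod : #K * ∑ w ∈ univ.filter fun w : weylGroup Sig => ⟪X, w.1 Y⟫ = ⟪X, Y⟫, dsign w.1 *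
      (linePoly T (w.1⁻¹ X) (w.1⁻¹ v)).coeff #(S ∩ T) *
        (⟪v, w.1 Y⟫ ^ (#S - #(S ∩ T)) / (#S - #(S ∩ T)).factorial) =
      #B * ∑ w ∈ A, dsign w.1 * ⟪v, w.1 Y⟫ ^ (#S - #(S ∩ T)) * piP (S ∩ T) (w.1⁻¹ v) *
        (piP (T \ (S ∩ T)) X / (#S - #(S ∩ T)).factorial) := by
    refine card_mul_sum_mul_set (A := A) ?_ ?_ ?_ ?_ ?_
    · intro a ha s hs
      rw [hmA] at ha ⊢
      exact (congrArg a.1 ((hmK s).1 hs).1).trans ha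
    · intro s hs b hb
      rw [hmB] at hb ⊢
      have : s.1⁻¹ (b.1 Y) = Y := by
        rw [hb, LinearIsometryEquiv.coe_inv, LinearIsometryEquiv.symm_apply_eq,
          ((hmK s).1 hs).2]
      exact this
    · intro a ha a' ha' b hb b' hb' h
      have hX' : a.1⁻¹ (a'.1 X) = X := by
        rw [(hmA _).1 ha', LinearIsometryEquiv.coe_inv, LinearIsometryEquiv.symm_apply_eq,
          (hmA _).1 ha]
      have h' : a⁻¹ * a' = b * b'⁻¹ := by
        rw [inv_mul_eq_iff_eq_mul, ← mul_assoc, h, mul_inv_cancel_right]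
      have hY' : b.1 (b'.1⁻¹ Y) = Y := by
        rw [show b'.1⁻¹ Y = Y by
          rw [LinearIsometryEquiv.coe_inv, LinearIsometryEquiv.symm_apply_eq, (hmB _).1 hb'],
          (hmB _).1 hb]
      rw [hmK]
      exact ⟨hX', by rw [h']; exact hY'⟩
    · intro w
      rw [mem_filter, hKM w]
      simp only [mem_univ, true_and, hmA, hmB]
      exact ⟨fun ⟨a, b, ha, hb, h⟩ => ⟨a, ha, b, hb, h⟩, fun ⟨a, ha, b, hb, h⟩ => ⟨a, b, ha, hb, h⟩⟩
    · intro a ha b hb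
      rw [hmA] at ha
      rw [hmB] at hb
      rw [hv.linePoly_inv_mul hroot hT ha hb, Polynomial.coeff_C_mul,
        coeff_linePoly_card inter_subset_right fun α hα => hSX α (mem_inter.1 hα).1,
        Subgroup.coe_mul, dsign_mul, LinearIsometryEquiv.coe_mul, Function.comp_apply, hb]
      linear_combination (dsign a.1 * (piP (S ∩ T) (a.1⁻¹ v) * piP (T \ (S ∩ T)) X) *
        (⟪v, a.1 Y⟫ ^ (#S - #(S ∩ T)) / (#S - #(S ∩ T)).factorial)) *
        dsign_mul_self hroot.1 b.2
  have hstab := hv.cConst_mul_sum_stabilizer hroot hS inter_subset_left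
    (fun α hα => hTY α (mem_inter.1 hα).2) hST hA hK
  rw [← sum_mul] at hprod
  have hcS : cConst S ≠ 0 := hv.cConst_ne_zero hroot (stabLike_stabilizer X) hS
    ⟨1, mem_filter.2 ⟨mem_univ _, rfl⟩⟩
  have hcT : cConst T ≠ 0 := hv.cConst_ne_zero hroot (stabLike_stabilizer Y) hT
    ⟨1, mem_filter.2 ⟨mem_univ _, rfl⟩⟩
  have hKpos : (#K : ℝ) ≠ 0 := by
    exact_mod_cast (card_pos.2 ⟨1, (hmK 1).2 ⟨rfl, rfl⟩⟩).ne'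
  have hfac : ((#S - #(S ∩ T)).factorial : ℝ) ≠ 0 := by exact_mod_cast Nat.factorial_ne_zero _
  have hSv := (hv.piP_pos hSsub).ne'
  have hX0 : piP (Sp \ S) X ≠ 0 := prod_ne_zero_iff.2 fun α hα h =>
    (mem_sdiff.1 hα).2 (by rw [hS]; exact mem_filter.2 ⟨(mem_sdiff.1 hα).1, h⟩)
  have hY0 : piP (Sp \ T) Y ≠ 0 := prod_ne_zero_iff.2 fun α hα h =>
    (mem_sdiff.1 hα).2 (by rw [hT]; exact mem_filter.2 ⟨(mem_sdiff.1 hα).1, h⟩)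
  have hXM : piP (Sp \ (S ∪ T)) X * piP (T \ (S ∩ T)) X = piP (Sp \ S) X := by
    rw [← piP_sdiff_mul (show T \ (S ∩ T) ⊆ Sp \ S from fun α hα => by
      simp only [mem_sdiff, mem_inter] at hα ⊢
      exact ⟨hTsub hα.1, fun h => hα.2 ⟨h, hα.1⟩⟩)]
    congr 2
    ext α
    simp only [mem_sdiff, mem_inter, mem_union]
    tauto
  have hYM : piP (Sp \ (S ∪ T)) Y * piP (S \ (S ∩ T)) Y = piP (Sp \ T) Y := by
    rw [← piP_sdiff_mul (show S \ (S ∩ T) ⊆ Sp \ T from fun α hα => by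
      simp only [mem_sdiff, mem_inter] at hα ⊢
      exact ⟨hSsub hα.1, fun h => hα.2 ⟨hα.1, h⟩⟩)]
    congr 2
    ext α
    simp only [mem_sdiff, mem_inter, mem_union]
    tauto
  have hC : piP S v * piP (Sp \ S) X * (cConst T * piP (Sp \ T) Y) ≠ 0 :=
    mul_ne_zero (mul_ne_zero hSv hX0) (mul_ne_zero hcT hY0)
  have h1 := (hv.tendsto_const_mul_quotient hroot hX hY hKM hS hT hgc hg).const_mul
    (piP S v * piP (Sp \ S) X * (cConst T * piP (Sp \ T) Y))⁻¹
  simp only [inv_mul_cancel_left₀ hC] at h1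
  convert h1 using 2
  rw [eq_inv_mul_iff_mul_eq₀ hC]
  refine mul_left_cancel₀ hKpos ?_
  rw [hprod]
  refine mul_left_cancel₀ hcS ?_
  rw [mul_left_comm (cConst S) (#B : ℝ), ← mul_assoc (cConst S) (∑ w ∈ A, _), hstab]
  rw [← hXM] at hX0 ⊢
  rw [← hYM] at hY0 ⊢
  have := left_ne_zero_of_mul hX0
  have := left_ne_zero_of_mul hY0
  field_simp

end LargeParameter

lemma sum_dsign_mul_exp_neg_norm_sub_sq {d : ℕ} {Sig : Finset (E d)} [Fintype (weylGroup Sig)]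
    {t : ℝ} (ht : t ≠ 0) (x y : E d) :
    ∑ w : weylGroup Sig, dsign w.1 * Real.exp (-‖x - w.1 y‖ ^ 2 / (4 * t)) =
      Real.exp (-(‖x‖ ^ 2 + ‖y‖ ^ 2) / (4 * t)) *
        ∑ w : weylGroup Sig, dsign w.1 * Real.exp ((2 * t)⁻¹ * ⟪x, w.1 y⟫) := by
  rw [mul_sum]
  refine sum_congr rfl fun w _ => ?_
  rw [mul_left_comm, ← Real.exp_add, norm_sub_sq_real, LinearIsometryEquiv.norm_map]
  congr 2
  field_simp
  ring

lemma PositiveFor.dense_setOf_piP_mul_ne_zero {d : ℕ} {Sig Sp : Finset (E d)} {v : E d}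
    (hv : PositiveFor Sig Sp v) :
    Dense {p : E d × E d | piP Sp p.1 * piP Sp p.2 ≠ 0} := by
  have h := dense_forall_inner_ne_zero Sp fun α hα => hv.ne_zero hα
  refine (h.prod h).mono fun p hp => mul_ne_zero ?_ ?_
  · exact prod_ne_zero_iff.2 hp.1
  · exact prod_ne_zero_iff.2 hp.2

/-- small-time asymptotics of the heat kernel. For each `t > 0` there is a
unique continuous `P_t` on `ℝ^d × ℝ^d` with
`P_t(X,Y) = (|W| (4πt)^{d/2} π(X)π(Y))⁻¹ ∑_{w∈W} det(w) exp(-|X-wY|²/(4t))` whenever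
`π(X)π(Y) ≠ 0`; and for singular `X, Y` in the closed chamber with the Killing-max property,
`t^{d/2+m'} e^{|X-Y|²/(4t)} P_t(X,Y) → (c_{X,Y}/(c_X c_Y)) (|W_X||W_Y|/|W_X∩W_Y|)
(π_M(X)π_M(Y))⁻¹ 2^{-m'-d} π^{-d/2} |W|⁻¹` as `t → 0⁺`. -/
theorem stmt_10 (d : ℕ) (hd : 1 ≤ d) (Sig Sp : Finset (E d))
    (hroot : IsRootSystem Sig) (hpos : IsPositiveSystem Sig Sp)
    [Fintype ↥(weylGroup Sig)]
    (X Y : E d)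
    (hXchamber : ∀ α ∈ Sp, 0 ≤ ⟪α, X⟫) (hYchamber : ∀ α ∈ Sp, 0 ≤ ⟪α, Y⟫)
    (hXsing : ∃ α ∈ Sig, ⟪α, X⟫ = 0) (hYsing : ∃ α ∈ Sig, ⟪α, Y⟫ = 0)
    (hKM : ∀ w : ↥(weylGroup Sig), ⟪X, w.1 Y⟫ = ⟪X, Y⟫ ↔
      ∃ w₁ w₂ : ↥(weylGroup Sig), w₁.1 X = X ∧ w₂.1 Y = Y ∧ w = w₁ * w₂)
    (SX SY M : Finset (E d))
    (hSX : SX = Sp.filter (fun α => ⟪α, X⟫ = 0))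
    (hSY : SY = Sp.filter (fun α => ⟪α, Y⟫ = 0))
    (hM : M = Sp \ (SX ∪ SY))
    (m' : ℕ) (hm' : m' = (SX ∪ SY).card)
    (WX WY WXY : Finset ↥(weylGroup Sig))
    (hWX : WX = Finset.univ.filter (fun w : ↥(weylGroup Sig) => w.1 X = X))
    (hWY : WY = Finset.univ.filter (fun w : ↥(weylGroup Sig) => w.1 Y = Y))
    (hWXY : WXY = Finset.univ.filter
      (fun w : ↥(weylGroup Sig) => w.1 X = X ∧ w.1 Y = Y)) :
    ∃ P : ℝ → E d × E d → ℝ,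
      (∀ t : ℝ, 0 < t →
        Continuous (P t) ∧
        (∀ X' Y' : E d, piP Sp X' * piP Sp Y' ≠ 0 →
          P t (X', Y') = ((Fintype.card ↥(weylGroup Sig) : ℝ) *
              (4 * Real.pi * t) ^ ((d : ℝ) / 2) * piP Sp X' * piP Sp Y')⁻¹ *
            ∑ w : ↥(weylGroup Sig), dsign w.1 * Real.exp (-‖X' - w.1 Y'‖ ^ 2 / (4 * t))) ∧
        (∀ Q : E d × E d → ℝ, Continuous Q →
          (∀ X' Y' : E d, piP Sp X' * piP Sp Y' ≠ 0 →
            Q (X', Y') = ((Fintype.card ↥(weylGroup Sig) : ℝ) *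
                (4 * Real.pi * t) ^ ((d : ℝ) / 2) * piP Sp X' * piP Sp Y')⁻¹ *
              ∑ w : ↥(weylGroup Sig), dsign w.1 * Real.exp (-‖X' - w.1 Y'‖ ^ 2 / (4 * t))) →
          Q = P t)) ∧
      Filter.Tendsto
        (fun t : ℝ => t ^ ((d : ℝ) / 2 + (m' : ℝ)) * Real.exp (‖X - Y‖ ^ 2 / (4 * t)) *
          P t (X, Y))
        (nhdsWithin 0 (Set.Ioi 0))
        (nhds ((cConst (SX ∩ SY) / (cConst SX * cConst SY)) *
          ((WX.card : ℝ) * (WY.card : ℝ) / (WXY.card : ℝ)) *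
          (piP M X * piP M Y)⁻¹ *
          (2 : ℝ) ^ (-(m' : ℤ) - (d : ℤ)) * Real.pi ^ (-(d : ℝ) / 2) *
          (Fintype.card ↥(weylGroup Sig) : ℝ)⁻¹)) := by
  obtain ⟨v, hv⟩ := hpos
  replace hv : PositiveFor Sig Sp v := hv
  choose g hgc hg using hv.exists_continuous_quotient hroot
  have hdense := hv.dense_setOf_piP_mul_ne_zero
  refine ⟨fun t p => ((Fintype.card (weylGroup Sig) : ℝ) * (4 * Real.pi * t) ^ ((d : ℝ) / 2))⁻¹ *
    (Real.exp (-(‖p.1‖ ^ 2 + ‖p.2‖ ^ 2) / (4 * t)) * g (2 * t)⁻¹ p), fun t ht => ?_, ?_⟩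
  · have hc : Continuous fun p : E d × E d =>
        ((Fintype.card (weylGroup Sig) : ℝ) * (4 * Real.pi * t) ^ ((d : ℝ) / 2))⁻¹ *
          (Real.exp (-(‖p.1‖ ^ 2 + ‖p.2‖ ^ 2) / (4 * t)) * g (2 * t)⁻¹ p) := by
      have := hgc (2 * t)⁻¹
      fun_prop
    have hform : ∀ X' Y' : E d, piP Sp X' * piP Sp Y' ≠ 0 →
        ((Fintype.card (weylGroup Sig) : ℝ) * (4 * Real.pi * t) ^ ((d : ℝ) / 2))⁻¹ *
          (Real.exp (-(‖X'‖ ^ 2 + ‖Y'‖ ^ 2) / (4 * t)) * g (2 * t)⁻¹ (X', Y')) =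
        ((Fintype.card (weylGroup Sig) : ℝ) *
            (4 * Real.pi * t) ^ ((d : ℝ) / 2) * piP Sp X' * piP Sp Y')⁻¹ *
          ∑ w : weylGroup Sig, dsign w.1 * Real.exp (-‖X' - w.1 Y'‖ ^ 2 / (4 * t)) := by
      intro X' Y' h
      rw [sum_dsign_mul_exp_neg_norm_sub_sq ht.ne', hg, mul_assoc _ (piP Sp X'),
        mul_inv _ (piP Sp X' * piP Sp Y'), mul_assoc _ (piP Sp X' * piP Sp Y')⁻¹,
        mul_left_comm (Real.exp _), inv_mul_cancel_left₀ h]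
    refine ⟨hc, hform, fun Q hQ hQf => Continuous.ext_on hdense hQ hc ?_⟩
    rintro ⟨x, y⟩ hxy
    exact (hQf x y hxy).trans (hform x y hxy).symm
  · have hinv : Filter.Tendsto (fun t : ℝ => (2 * t)⁻¹)
        (nhdsWithin 0 (Set.Ioi 0)) Filter.atTop := by
      simp only [mul_inv]
      exact tendsto_inv_nhdsGT_zero.const_mul_atTop (by norm_num)
    have h1 := ((hv.tendsto_quotient hroot hXchamber hYchamber hKM hSX hSY hWX hWY hWXY hgc
      hg).comp hinv).mul_const
        ((2 : ℝ) ^ (-(m' : ℤ) - (d : ℤ)) * Real.pi ^ (-(d : ℝ) / 2) *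
          (Fintype.card (weylGroup Sig) : ℝ)⁻¹)
    rw [← hM] at h1
    simp only [mul_assoc] at h1 ⊢
    refine h1.congr' ?_
    filter_upwards [self_mem_nhdsWithin] with t ht
    have ht' : 0 < t := ht
    have hexp : Real.exp (‖X - Y‖ ^ 2 / (4 * t)) * Real.exp (-(‖X‖ ^ 2 + ‖Y‖ ^ 2) / (4 * t)) =
        Real.exp (-((2 * t)⁻¹ * ⟪X, Y⟫)) := by
      rw [← Real.exp_add, norm_sub_sq_real]
      congr 1
      field_simp
      ring
    have h4 : (4 : ℝ) ^ ((d : ℝ) / 2) = 2 ^ d := by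
      rw [show (4 : ℝ) = 2 ^ (2 : ℝ) by norm_num, ← Real.rpow_mul (by norm_num),
        mul_div_cancel₀ _ (by norm_num), Real.rpow_natCast]
    rw [Function.comp_apply, ← hexp, ← hm', Real.rpow_add ht', Real.rpow_natCast,
      Real.mul_rpow (by norm_num) (by positivity), Real.mul_rpow Real.pi_pos.le ht'.le, h4,
      neg_div (2 : ℝ) (d : ℝ), Real.rpow_neg Real.pi_pos.le, zpow_sub₀ (by norm_num), zpow_neg,
      zpow_natCast, zpow_natCast, inv_pow, inv_inv, mul_pow]
    have hp := Real.rpow_pos_of_pos ht' ((d : ℝ) / 2)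
    field_simp
end
end

section
/- Let n ≥ 1 and let G ≤ O(ℝⁿ) be the group of signed permutations: the linear maps g of ℝⁿ of the form (g x)ᵢ = εᵢ x_{σ⁻¹(i)} for some σ ∈ Sₙ and ε ∈ {−1, 1}ⁿ. Let λ, y ∈ ℝⁿ satisfy λ₁ ≥ λ₂ ≥ … ≥ λₙ ≥ 0 and y₁ ≥ y₂ ≥ … ≥ yₙ ≥ 0. Then for every g ∈ G, ⟨λ, g y⟩ = ⟨λ, y⟩ if and only if there exist g₁, g₂ ∈ G with g₁ λ = λ, g₂ y = y and g = g₁ ∘ g₂. (This is the Killing-max property for the Weyl groups of the root systems Bₙ and Cₙ.) -/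
open scoped BigOperators

/-- The group of signed permutations of `ℝⁿ` (the Weyl group of type `Bₙ/Cₙ`), described as
the set of maps `x ↦ (ε i * x (σ⁻¹ i)) i` with `σ` a permutation and each `ε i ∈ {−1, 1}`. -/
def SignedPerm (n : ℕ) : Set ((Fin n → ℝ) → Fin n → ℝ) :=
  {g | ∃ (σ : Equiv.Perm (Fin n)) (ε : Fin n → ℝ),
    (∀ i, ε i = 1 ∨ ε i = -1) ∧ ∀ (x : Fin n → ℝ) (i : Fin n), g x i = ε i * x (σ⁻¹ i)}

/-- Two real tuples that vary together can be sorted into decreasing order simultaneously. -/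
lemma Monovary.exists_perm_antitone {n : ℕ} {f g : Fin n → ℝ} (h : Monovary f g) :
    ∃ τ : Equiv.Perm (Fin n), Antitone (f ∘ τ) ∧ Antitone (g ∘ τ) := by
  refine ⟨Tuple.sort (-(f + g)), ?_, ?_⟩ <;>
  · intro i j hij
    have hs := Tuple.monotone_sort (-(f + g)) hij
    simp only [Function.comp_apply, Pi.neg_apply, Pi.add_apply] at hs ⊢
    by_contra! hlt
    first
      | linarith [h hlt]
      | linarith [h.symm hlt]

/-- If a signed rearrangement of `y` attains the maximal pairing with `lam`, then no sign change
affects a nonzero term, and the rearrangement is undone by a permutation preserving `lam`. -/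
lemma exists_perm_of_sum_signed_comp_perm_eq {n : ℕ} {lam y ε : Fin n → ℝ}
    (hlam : Antitone lam) (hlam0 : ∀ i, 0 ≤ lam i) (hy : Antitone y) (hy0 : ∀ i, 0 ≤ y i)
    (σ : Equiv.Perm (Fin n)) (hε : ∀ i, ε i = 1 ∨ ε i = -1)
    (h : ∑ i, lam i * (ε i * y (σ i)) = ∑ i, lam i * y i) :
    (∀ i, ε i = 1 ∨ lam i = 0 ∨ y (σ i) = 0) ∧
      ∃ τ : Equiv.Perm (Fin n), (∀ i, lam (τ i) = lam i) ∧ ∀ i, y (σ (τ i)) = y i := by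
  have hmono : Monovary lam y := hlam.monovary hy
  have hterm : ∀ i ∈ Finset.univ, lam i * (ε i * y (σ i)) ≤ lam i * y (σ i) := by
    intro i _
    have := mul_nonneg (hlam0 i) (hy0 (σ i))
    rcases hε i with h1 | h1 <;> rw [h1] <;> linarith
  have hsum := Finset.sum_le_sum hterm
  have hrearr : ∑ i, lam i * y (σ i) ≤ ∑ i, lam i * y i := hmono.sum_mul_comp_perm_le_sum_mul
  have heq := (Finset.sum_eq_sum_iff_of_le hterm).1 (by linarith)
  refine ⟨fun i => ?_, ?_⟩
  · rcases hε i with h1 | h1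
    · exact Or.inl h1
    · have := heq i (Finset.mem_univ i)
      rw [h1] at this
      exact Or.inr (mul_eq_zero.1 (by linarith))
  · obtain ⟨τ, hτlam, hτy⟩ :=
      (hmono.sum_mul_comp_perm_eq_sum_mul_iff.1
        (show ∑ i, lam i * y (σ i) = _ by linarith)).exists_perm_antitone
    exact ⟨τ, congrFun (Tuple.unique_antitone (τ := 1) hτlam hlam),
      congrFun (Tuple.unique_antitone (σ := σ * τ) (τ := 1) hτy hy)⟩

/-- A signed permutation fixing `lam` does not change the pairing with `lam`. -/
lemma SignedPerm.sum_mul_apply_of_fixed {n : ℕ} {g : (Fin n → ℝ) → Fin n → ℝ}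
    (hg : g ∈ SignedPerm n) {lam : Fin n → ℝ} (hfix : g lam = lam) (x : Fin n → ℝ) :
    ∑ i, lam i * g x i = ∑ i, lam i * x i := by
  obtain ⟨σ, ε, hε, h⟩ := hg
  rw [← Equiv.sum_comp σ⁻¹ (fun i => lam i * x i)]
  refine Finset.sum_congr rfl fun i _ => ?_
  have hi := congrFun hfix i
  rw [h] at hi
  rw [h, ← hi]
  rcases hε i with h1 | h1 <;> rw [h1] <;> ring

/-- Killing-max property for the root systems `Bₙ` and `Cₙ`. For
`λ₁ ≥ … ≥ λₙ ≥ 0` and `y₁ ≥ … ≥ yₙ ≥ 0` and any signed permutation `g`,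
`⟨λ, g y⟩ = ⟨λ, y⟩` iff `g = g₁ ∘ g₂` with `g₁, g₂` signed permutations fixing `λ` and `y`
respectively. -/
theorem stmt_13 (n : ℕ) (hn : 1 ≤ n) (lam y : Fin n → ℝ)
    (hlam : Antitone lam) (hlam0 : ∀ i, 0 ≤ lam i)
    (hy : Antitone y) (hy0 : ∀ i, 0 ≤ y i)
    (g : (Fin n → ℝ) → Fin n → ℝ) (hg : g ∈ SignedPerm n) :
    (∑ i : Fin n, lam i * g y i) = (∑ i : Fin n, lam i * y i) ↔
      ∃ g₁ ∈ SignedPerm n, ∃ g₂ ∈ SignedPerm n,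
        g₁ lam = lam ∧ g₂ y = y ∧ g = g₁ ∘ g₂ := by
  constructor
  · obtain ⟨σ, ε, hε, hg⟩ := hg
    simp only [hg]
    intro h
    obtain ⟨hsign, τ, hτlam, hτy⟩ :=
      exists_perm_of_sum_signed_comp_perm_eq hlam hlam0 hy hy0 σ⁻¹ hε h
    let δ : Fin n → ℝ := fun i => if lam i = 0 then ε i else 1
    have hδ : ∀ i, δ i = 1 ∨ δ i = -1 := fun i => by
      by_cases h0 : lam i = 0 <;> simp [δ, h0, hε i]
    have hττ : ∀ i, τ (τ⁻¹ i) = i := τ.apply_symm_apply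
    refine ⟨fun x i => δ i * x (τ⁻¹ i), ⟨τ, δ, hδ, fun _ _ => rfl⟩,
      fun x j => δ (τ j) * ε (τ j) * x (σ⁻¹ (τ j)),
      ⟨τ⁻¹ * σ, fun j => δ (τ j) * ε (τ j), fun j => ?_, fun x j => by simp⟩, ?_, ?_, ?_⟩
    · rcases hδ (τ j) with h1 | h1 <;> rcases hε (τ j) with h2 | h2 <;> simp [h1, h2]
    · ext i
      have hi := hτlam (τ⁻¹ i)
      rw [hττ] at hi
      change δ i * lam (τ⁻¹ i) = lam i
      rw [← hi]
      by_cases h0 : lam i = 0 <;> simp [δ, h0]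
    · ext j
      simp only [hτy]
      rcases hsign (τ j) with h1 | h1 | h1
      · simp [δ, h1]
      · rcases hε (τ j) with h2 | h2 <;> simp [δ, h1, h2]
      · rw [← hτy j, h1, mul_zero]
    · ext x i
      simp only [hg, Function.comp_apply, hττ]
      rcases hδ i with h1 | h1 <;> rw [h1] <;> ring
  · rintro ⟨g₁, hg₁, g₂, -, h₁, h₂, rfl⟩
    rw [Function.comp_apply, h₂, SignedPerm.sum_mul_apply_of_fixed hg₁ h₁]
end
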